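/- arXiv:2103.08437 — 4 statements merged into one kernel-verified Lean document; each statement's English description precedes it below -/
import Mathlib

section
/- Let F be a graph of type I (i.e., F has two adjacent vertices u₁ and u₂ whose degrees are the smallest and second smallest values in the degree sequence of F). Then for every r ≥ 3 there is a constant C = C(F, r) such that sat_r(n, F) ≤ C·n for all n. -/
def SimpleGraph.IsBergeCopyIn {α V : Type*} (F : SimpleGraph α) (H : Finset (Finset V)) : Prop :=
  ∃ (φ : α → V) (f : Sym2 α → Finset V), Function.Injective φ ∧
    Set.InjOn f F.edgeSet ∧ ∀ e ∈ F.edgeSet, f e ∈ H ∧ ∀ a ∈ e, φ a ∈ f e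

def BergeSaturated {α : Type*} (F : SimpleGraph α) (r n : ℕ)
    (H : Finset (Finset (Fin n))) : Prop :=
  (∀ h ∈ H, h.card = r) ∧ ¬ F.IsBergeCopyIn H ∧
    ∀ h : Finset (Fin n), h.card = r → h ∉ H → F.IsBergeCopyIn (insert h H)

open Finset in
theorem aux_pi {α : Type*} [DecidableEq α] (A B : Finset α) (h : A.card ≤ B.card) :
    ∃ π : α → α, Set.InjOn π A ∧ (∀ a ∈ A, π a ∈ B) ∧ ∀ a ∈ A, a ∈ B → π a = a := by
  have h1 : (A \ B).card ≤ (B \ A).card := by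
    have e1 := Finset.card_sdiff_add_card_inter A B
    have e2 := Finset.card_sdiff_add_card_inter B A
    rw [Finset.inter_comm B A] at e2
    omega
  obtain ⟨C, hC, hcard⟩ := Finset.exists_subset_card_eq h1
  have e := Finset.equivOfCardEq hcard.symm
  refine ⟨fun a => if ha : a ∈ A \ B then (e ⟨a, ha⟩ : α) else a, ?_, ?_, ?_⟩
  · have key : ∀ a (ha : a ∈ A \ B), (e ⟨a, ha⟩ : α) ∈ B \ A := fun a ha => hC (e ⟨a, ha⟩).2
    intro a ha b hb hab
    simp only [Finset.mem_coe] at ha hb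
    by_cases h1 : a ∈ A \ B <;> by_cases h2 : b ∈ A \ B
    · simp only [h1, h2, dif_pos] at hab
      have := e.injective (Subtype.ext hab)
      simpa using this
    · simp only [h1, h2, dif_pos, dif_neg, not_false_eq_true] at hab
      have := key a h1
      rw [hab] at this
      exact absurd hb (Finset.mem_sdiff.1 this).2
    · simp only [h1, h2, dif_pos, dif_neg, not_false_eq_true] at hab
      have := key b h2
      rw [← hab] at this
      exact absurd ha (Finset.mem_sdiff.1 this).2
    · simpa only [h1, h2, dif_neg, not_false_eq_true] using hab
  · intro a ha
    by_cases h1 : a ∈ A \ B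
    · simp only [h1, dif_pos]
      exact (Finset.mem_sdiff.1 (hC (e ⟨a, h1⟩).2)).1
    · simp only [h1, dif_neg, not_false_eq_true]
      by_contra hb
      exact h1 (Finset.mem_sdiff.2 ⟨ha, hb⟩)
  · intro a ha hb
    have h1 : a ∉ A \ B := by simp [hb]
    simp only [h1, dif_neg, not_false_eq_true]

theorem aux_T {α : Type*} [DecidableEq α] (A B : Finset α) (h : A.card ≤ B.card) :
    ∃ (π : α → α) (T : α → Finset α), Set.InjOn π A ∧ (∀ a ∈ A, π a ∈ B) ∧
      (∀ a ∈ A, a ∈ T (π a)) ∧ (∀ b, b ∈ T b) ∧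
      (∀ b ∈ B, ∀ b' ∈ B, b' ∈ T b → b' = b) ∧ (∀ b, ∀ c ∈ T b, c = b ∨ c ∈ A) ∧
      (∀ b, (T b).card = 1 ∨ (T b).card = 2) := by
  obtain ⟨π, h1, h2, h3⟩ := aux_pi A B h
  refine ⟨π, fun b => insert b (A.filter (fun a => π a = b)), h1, h2, ?_, ?_, ?_, ?_, ?_⟩
  · intro a ha; simp [ha]
  · intro b; simp
  · intro b hb b' hb' hm
    simp only [Finset.mem_insert, Finset.mem_filter] at hm
    rcases hm with hm | ⟨ha, hm⟩
    · exact hm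
    · rw [← hm, h3 b' ha hb']
  · intro b c hc
    simp only [Finset.mem_insert, Finset.mem_filter] at hc
    tauto
  · intro b
    have hle : (A.filter (fun a => π a = b)).card ≤ 1 := by
      rw [Finset.card_le_one]
      intro x hx y hy
      simp only [Finset.mem_filter] at hx hy
      exact h1 hx.1 hy.1 (hx.2.trans hy.2.symm)
    have a1 := Finset.card_insert_le b (A.filter (fun a => π a = b))
    have a2 : 0 < (insert b (A.filter (fun a => π a = b))).card :=
      Finset.card_pos.2 ⟨b, by simp⟩
    show (insert b (A.filter (fun a => π a = b))).card = 1 ∨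
      (insert b (A.filter (fun a => π a = b))).card = 2
    omega

/-- Berge copies are preserved by injections. -/
theorem aux_map {α V W : Type*} [DecidableEq V] [DecidableEq W] (F : SimpleGraph α)
    (H : Finset (Finset V)) (g : V → W) (hg : Function.Injective g)
    (h : F.IsBergeCopyIn H) : F.IsBergeCopyIn (H.image (fun s => s.image g)) := by
  obtain ⟨φ, f, h1, h2, h3⟩ := h
  refine ⟨g ∘ φ, fun e => (f e).image g, hg.comp h1, ?_, ?_⟩
  · intro a ha b hb hab
    exact h2 ha hb (Finset.image_injective hg hab)
  · intro e he
    exact ⟨Finset.mem_image_of_mem _ (h3 e he).1,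
      fun a ha => Finset.mem_image_of_mem _ ((h3 e he).2 a ha)⟩

theorem aux_mono {α V : Type*} (F : SimpleGraph α) {H H' : Finset (Finset V)} (hs : H ⊆ H')
    (h : F.IsBergeCopyIn H) : F.IsBergeCopyIn H' := by
  obtain ⟨φ, f, h1, h2, h3⟩ := h
  exact ⟨φ, f, h1, h2, fun e he => ⟨hs (h3 e he).1, (h3 e he).2⟩⟩

theorem aux_deg {α V : Type*} [Fintype α] [DecidableEq V] (F : SimpleGraph α) [DecidableRel F.Adj]
    (H : Finset (Finset V)) (φ : α → V) (f : Sym2 α → Finset V)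
    (h2 : Set.InjOn f F.edgeSet) (h3 : ∀ e ∈ F.edgeSet, f e ∈ H ∧ ∀ a ∈ e, φ a ∈ f e) (w : α) :
    F.degree w ≤ (H.filter (fun s => φ w ∈ s)).card := by
  rw [← SimpleGraph.card_neighborFinset_eq_degree]
  apply Finset.card_le_card_of_injOn (fun u => f s(w, u))
  · intro u hu
    have hu' : s(w, u) ∈ F.edgeSet := by simpa using hu
    have := h3 _ hu'
    simp only [Finset.coe_filter, Set.mem_ofPred_eq]
    exact ⟨this.1, this.2 w (by simp)⟩
  · intro u hu u' hu' huu
    have a1 : s(w, u) ∈ F.edgeSet := by simpa using hu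
    have a2 : s(w, u') ∈ F.edgeSet := by simpa using hu'
    have := h2 a1 a2 huu
    exact Sym2.congr_right.1 this

theorem aux_edges {α V : Type*} [Fintype α] (F : SimpleGraph α) [DecidableRel F.Adj]
    [DecidableEq α] (H : Finset (Finset V)) (h : F.IsBergeCopyIn H) :
    F.edgeFinset.card ≤ H.card := by
  obtain ⟨φ, f, h1, h2, h3⟩ := h
  apply Finset.card_le_card_of_injOn f
  · intro e he
    exact (h3 e (by simpa using he)).1
  · intro e he e' he'
    exact h2 (by simpa using he) (by simpa using he')

/-- Greedy completion. -/
theorem aux_greedy {α V : Type*} [Fintype V] [DecidableEq V] (F : SimpleGraph α) (r : ℕ)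
    (H0 Bad : Finset (Finset V)) (hcard : ∀ h ∈ H0, h.card = r) (hfree : ¬ F.IsBergeCopyIn H0)
    (hsat : ∀ h : Finset V, h.card = r → h ∉ H0 → h ∉ Bad → F.IsBergeCopyIn (insert h H0)) :
    ∃ H : Finset (Finset V), ((∀ h ∈ H, h.card = r) ∧ ¬ F.IsBergeCopyIn H ∧
      ∀ h : Finset V, h.card = r → h ∉ H → F.IsBergeCopyIn (insert h H)) ∧
      H.card ≤ H0.card + Bad.card := by
  classical
  let 𝒮 : Finset (Finset (Finset V)) := Finset.univ.filter
    (fun H => H0 ⊆ H ∧ (∀ h ∈ H, h.card = r) ∧ ¬ F.IsBergeCopyIn H)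
  have hne : 𝒮.Nonempty := ⟨H0, by simp [𝒮, hfree]; exact hcard⟩
  obtain ⟨H, hH, hmax⟩ := Finset.exists_max_image 𝒮 Finset.card hne
  simp only [𝒮, Finset.mem_filter, Finset.mem_univ, true_and] at hH hmax
  obtain ⟨hs, hc, hf⟩ := hH
  refine ⟨H, ⟨hc, hf, ?_⟩, ?_⟩
  · intro h hr hh
    by_contra hcon
    have := hmax (insert h H) ⟨hs.trans (Finset.subset_insert _ _), ?_, hcon⟩
    · rw [Finset.card_insert_of_notMem hh] at this
      omega
    · intro x hx
      rcases Finset.mem_insert.1 hx with rfl | hx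
      · exact hr
      · exact hc x hx
  · refine (Finset.card_le_card (?_ : H ⊆ H0 ∪ Bad)).trans (Finset.card_union_le _ _)
    intro h hh
    by_contra hcon
    simp only [Finset.mem_union, not_or] at hcon
    exact hf (aux_mono F (Finset.insert_subset hh hs) (hsat h (hc h hh) hcon.1 hcon.2))

theorem aux_transfer {α V : Type*} [DecidableEq V] (F : SimpleGraph α) (r n : ℕ)
    (e : V ≃ Fin n) (H : Finset (Finset V)) (h1 : ∀ h ∈ H, h.card = r)
    (h2 : ¬ F.IsBergeCopyIn H)
    (h3 : ∀ h : Finset V, h.card = r → h ∉ H → F.IsBergeCopyIn (insert h H)) :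
    BergeSaturated F r n (H.image (fun s => s.image e)) := by
  have back : ∀ s : Finset (Fin n), (s.image e.symm).image e = s := by
    intro s; simp [Finset.image_image]
  have forth : ∀ s : Finset V, (s.image e).image e.symm = s := by
    intro s; simp [Finset.image_image]
  refine ⟨?_, ?_, ?_⟩
  · intro h hh
    obtain ⟨s, hs, rfl⟩ := Finset.mem_image.1 hh
    rw [Finset.card_image_of_injective _ e.injective, h1 s hs]
  · intro hc
    apply h2
    have := aux_map F _ e.symm e.symm.injective hc
    rw [Finset.image_image] at this
    convert this
    have : ((fun s : Finset (Fin n) => s.image e.symm) ∘ fun s : Finset V => s.image e) = id := by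
      funext s; exact forth s
    rw [this, Finset.image_id]
  · intro h hh hn
    have := aux_map F _ e e.injective (h3 (h.image e.symm)
      (by rw [Finset.card_image_of_injective _ e.symm.injective, hh]) (fun hm => hn
        (Finset.mem_image.2 ⟨_, hm, back h⟩)))
    rw [Finset.image_insert, back] at this
    exact this

/-- The vertex set of the construction. -/
abbrev BV (α : Type*) (s l m : ℕ) : Type _ :=
  α ⊕ (Sym2 α × Fin s) ⊕ Fin l ⊕ (Fin m × Fin (s + 1) × Fin s)

abbrev outV {α : Type*} {s l m : ℕ} (x : Fin m × Fin (s + 1) × Fin s) : BV α s l m :=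
  Sum.inr (Sum.inr (Sum.inr x))

abbrev filV {α : Type*} {s l m : ℕ} (x : Sym2 α × Fin s) : BV α s l m :=
  Sum.inr (Sum.inl x)

open Classical in
noncomputable def fillE {α : Type*} (s l m : ℕ) (e : Sym2 α) : Finset (BV α s l m) :=
  e.toFinset.image Sum.inl ∪ Finset.univ.image (fun i : Fin s => filV (e, i))

open Classical in
noncomputable def lineE {α : Type*} {s l m : ℕ} (T : α → Finset α) (b : α)
    (x : Fin m × Fin (s + 1) × Fin s) : Finset (BV α s l m) :=
  (T b).image Sum.inl ∪ (if (T b).card = 1 then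
    Finset.univ.image (fun p => outV (x.1, p, x.2.2)) else
    Finset.univ.image (fun q => outV (x.1, x.2.1, q)))

open Classical in
noncomputable def HZ {α : Type*} (s l m : ℕ) (E : Finset (Sym2 α)) (B : Finset α)
    (T : α → Finset α) : Finset (Finset (BV α s l m)) :=
  E.image (fillE s l m) ∪ (B ×ˢ Finset.univ).image (fun z => lineE T z.1 z.2)

section
variable {α : Type*} {s l m : ℕ}

theorem inl_mem_fillE (e : Sym2 α) (a : α) :
    (Sum.inl a : BV α s l m) ∈ fillE s l m e ↔ a ∈ e := by
  simp [fillE]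

theorem fil_mem_fillE (e e' : Sym2 α) (i : Fin s) :
    (filV (e', i) : BV α s l m) ∈ fillE s l m e ↔ e' = e := by
  simp [fillE, eq_comm]

theorem lo_mem_fillE (e : Sym2 α) (i : Fin l) :
    (Sum.inr (Sum.inr (Sum.inl i)) : BV α s l m) ∉ fillE s l m e := by
  simp [fillE]

theorem out_mem_fillE (e : Sym2 α) (x) :
    (outV x : BV α s l m) ∉ fillE s l m e := by
  simp [fillE]

theorem inl_mem_lineE (T : α → Finset α) (b : α) (x) (a : α) :
    (Sum.inl a : BV α s l m) ∈ lineE T b x ↔ a ∈ T b := by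
  unfold lineE; split_ifs <;> simp

theorem fil_mem_lineE (T : α → Finset α) (b : α) (x) (z) :
    (filV z : BV α s l m) ∉ lineE T b x := by
  unfold lineE; split_ifs <;> simp

theorem lo_mem_lineE (T : α → Finset α) (b : α) (x) (i : Fin l) :
    (Sum.inr (Sum.inr (Sum.inl i)) : BV α s l m) ∉ lineE T b x := by
  unfold lineE; split_ifs <;> simp

theorem out_mem_lineE_self (T : α → Finset α) (b : α) (x) :
    (outV x : BV α s l m) ∈ lineE T b x := by
  unfold lineE; split_ifs <;> simp

theorem out_mem_lineE_fst (T : α → Finset α) (b : α) (x y)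
    (h : (outV y : BV α s l m) ∈ lineE T b x) : y.1 = x.1 := by
  obtain ⟨j, p, q⟩ := y
  obtain ⟨j', p', q'⟩ := x
  unfold lineE at h; split_ifs at h <;> simp at h <;> simp [h]

theorem out_mem_lineE_eq (T : α → Finset α) (b : α) (x y)
    (h : (outV y : BV α s l m) ∈ lineE T b x) :
    (lineE T b x : Finset (BV α s l m)) = lineE T b y := by
  obtain ⟨j, p, q⟩ := y
  obtain ⟨j', p', q'⟩ := x
  unfold lineE at h ⊢
  split_ifs at h ⊢ <;> simp at h <;> simp [h]

theorem card_fillE (e : Sym2 α) (he : ¬ e.IsDiag) : (fillE s l m e).card = s + 2 := by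
  classical
  unfold fillE
  rw [Finset.card_union_of_disjoint, Finset.card_image_of_injective _ Sum.inl_injective,
    Finset.card_image_of_injective]
  · have := Sym2.card_toFinset_of_not_isDiag e he
    have h' : e.toFinset.card = 2 := by convert this
    rw [h', Finset.card_univ, Fintype.card_fin, add_comm]
  · intro i j hij
    simpa using hij
  · rw [Finset.disjoint_left]
    intro a h1 h2
    simp only [Finset.mem_image] at h1 h2
    obtain ⟨x, _, rfl⟩ := h1
    obtain ⟨y, _, hy⟩ := h2
    simp at hy

theorem card_lineE (T : α → Finset α) (b : α) (x)
    (hT : (T b).card = 1 ∨ (T b).card = 2) :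
    (lineE T b x : Finset (BV α s l m)).card = s + 2 := by
  classical
  unfold lineE
  rw [Finset.card_union_of_disjoint, Finset.card_image_of_injective _ Sum.inl_injective]
  · split_ifs with h
    · rw [Finset.card_image_of_injective]
      · simp [h]; ring
      · intro i j hij
        simpa using hij
    · rw [Finset.card_image_of_injective]
      · simp; omega
      · intro i j hij
        simpa using hij
  · rw [Finset.disjoint_left]
    intro a h1 h2
    obtain ⟨x, _, rfl⟩ := Finset.mem_image.1 h1
    split_ifs at h2 <;> simp at h2

theorem mem_HZ (E : Finset (Sym2 α)) (B : Finset α) (T : α → Finset α)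
    (h : Finset (BV α s l m)) :
    h ∈ HZ s l m E B T ↔ (∃ e ∈ E, fillE s l m e = h) ∨ ∃ b ∈ B, ∃ x, lineE T b x = h := by
  classical
  simp only [HZ, Finset.mem_union, Finset.mem_image, Finset.mem_product, Finset.mem_univ, and_true]
  constructor
  · rintro (h | ⟨z, hz, h⟩)
    · exact Or.inl h
    · exact Or.inr ⟨z.1, hz, z.2, h⟩
  · rintro (h | ⟨b, hb, x, h⟩)
    · exact Or.inl h
    · exact Or.inr ⟨(b, x), hb, h⟩
end

open Classical in
theorem aux_copy {α : Type*} {s l m : ℕ} (hs : 0 < s) (F : SimpleGraph α) (u₁ u₂ : α)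
    (hne : u₁ ≠ u₂) (A B : Finset α) (E : Finset (Sym2 α))
    (hA : ∀ a, a ∈ A ↔ F.Adj u₁ a ∧ a ≠ u₂) (hB : ∀ a, a ∈ B ↔ F.Adj u₂ a ∧ a ≠ u₁)
    (hE : ∀ e, e ∈ E ↔ e ∈ F.edgeSet ∧ u₁ ∉ e ∧ u₂ ∉ e)
    (π : α → α) (T : α → Finset α) (hπ : Set.InjOn π A) (hπB : ∀ a ∈ A, π a ∈ B)
    (hT1 : ∀ a ∈ A, a ∈ T (π a)) (hT2 : ∀ b, b ∈ T b)
    (hT3 : ∀ b ∈ B, ∀ b' ∈ B, b' ∈ T b → b' = b)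
    (h : Finset (BV α s l m)) (hh : h ∉ HZ s l m E B T) (x y : Fin m × Fin (s + 1) × Fin s)
    (hxy : x.1 ≠ y.1) (hx : outV x ∈ h) (hy : outV y ∈ h) :
    F.IsBergeCopyIn (insert h (HZ s l m E B T)) := by
  let φ : α → BV α s l m := fun a => if a = u₁ then outV x else if a = u₂ then outV y else Sum.inl a
  let f : Sym2 α → Finset (BV α s l m) := fun e =>
    if e = s(u₁, u₂) then h else if h1 : u₁ ∈ e then lineE T (π (Sym2.Mem.other h1)) x else
      if h2 : u₂ ∈ e then lineE T (Sym2.Mem.other h2) y else fillE s l m e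
  have φ1 : φ u₁ = outV x := by simp [φ]
  have φ2 : φ u₂ = outV y := by simp [φ, hne.symm]
  have φ3 : ∀ a, a ≠ u₁ → a ≠ u₂ → φ a = Sum.inl a := by
    intro a h1 h2; simp [φ, h1, h2]
  have cls : ∀ e ∈ F.edgeSet, (e = s(u₁, u₂) ∧ f e = h) ∨
      (∃ a ∈ A, e = s(u₁, a) ∧ f e = lineE T (π a) x) ∨
      (∃ b ∈ B, e = s(u₂, b) ∧ f e = lineE T b y) ∨ (e ∈ E ∧ f e = fillE s l m e) := by
    intro e he
    by_cases c0 : e = s(u₁, u₂)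
    · exact Or.inl ⟨c0, by simp [f, c0]⟩
    by_cases c1 : u₁ ∈ e
    · right; left
      have ho := Sym2.other_spec c1
      refine ⟨Sym2.Mem.other c1, ?_, ho.symm, by simp only [f, c0, c1, if_false, dif_pos]⟩
      rw [hA]
      constructor
      · rw [← ho] at he; exact he
      · intro hc; rw [hc] at ho; exact c0 ho.symm
    by_cases c2 : u₂ ∈ e
    · right; right; left
      have ho := Sym2.other_spec c2
      refine ⟨Sym2.Mem.other c2, ?_, ho.symm, by
        simp only [f, c0, c1, c2, if_false, dif_pos, dif_neg, not_false_eq_true]⟩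
      rw [hB]
      constructor
      · rw [← ho] at he; exact he
      · intro hc; rw [hc] at ho; exact c0 (by rw [← ho, Sym2.eq_swap])
    · right; right; right
      exact ⟨(hE e).2 ⟨he, c1, c2⟩, by
        simp only [f, c0, c1, c2, if_false, dif_neg, not_false_eq_true]⟩
  have lineinj : ∀ b ∈ B, ∀ b' ∈ B, ∀ z w,
      (lineE T b z : Finset (BV α s l m)) = lineE T b' w → b = b' := by
    intro b hb b' hb' z w hzw
    apply hT3 b' hb' b hb
    rw [← inl_mem_lineE (s := s) (l := l) (m := m) T b' w, ← hzw, inl_mem_lineE]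
    exact hT2 b
  have linexy : ∀ b b', (lineE T b x : Finset (BV α s l m)) ≠ lineE T b' y := by
    intro b b' hzw
    have := out_mem_lineE_self (l := l) T b x
    rw [hzw] at this
    exact hxy (out_mem_lineE_fst T b' y x this)
  have linefill : ∀ b z e, (lineE T b z : Finset (BV α s l m)) ≠ fillE s l m e := by
    intro b z e hzw
    have := out_mem_lineE_self (l := l) T b z
    rw [hzw] at this
    exact out_mem_fillE _ _ this
  have fillinj : ∀ e e' : Sym2 α, fillE s l m e = fillE s l m e' → e = e' := by
    intro e e' hee
    have := (fil_mem_fillE (l := l) (m := m) e e ⟨0, hs⟩).2 rfl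
    rw [hee, fil_mem_fillE] at this
    exact this
  have hmem1 : ∀ b ∈ B, ∀ z, lineE T b z ∈ HZ s l m E B T := fun b hb z =>
    (mem_HZ _ _ _ _).2 (Or.inr ⟨b, hb, z, rfl⟩)
  have hmem2 : ∀ e ∈ E, fillE s l m e ∈ HZ s l m E B T := fun e he =>
    (mem_HZ _ _ _ _).2 (Or.inl ⟨e, he, rfl⟩)
  have hn1 : ∀ b ∈ B, ∀ z, lineE T b z ≠ h := fun b hb z hc => hh (hc ▸ hmem1 b hb z)
  have hn2 : ∀ e ∈ E, fillE s l m e ≠ h := fun e he hc => hh (hc ▸ hmem2 e he)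
  refine ⟨φ, f, ?_, ?_, ?_⟩
  · intro a b hab
    have hxy' : x ≠ y := fun hc => hxy (by rw [hc])
    by_cases a1 : a = u₁ <;> by_cases b1 : b = u₁
    · rw [a1, b1]
    · by_cases b2 : b = u₂
      · rw [a1, b2, φ1, φ2] at hab
        simp [hxy'] at hab
      · rw [a1, φ1, φ3 b b1 b2] at hab
        simp at hab
    · by_cases a2 : a = u₂
      · rw [a2, b1, φ1, φ2] at hab
        simp [hxy'.symm] at hab
      · rw [b1, φ1, φ3 a a1 a2] at hab
        simp at hab
    · by_cases a2 : a = u₂ <;> by_cases b2 : b = u₂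
      · rw [a2, b2]
      · rw [a2, φ2, φ3 b b1 b2] at hab
        simp at hab
      · rw [b2, φ2, φ3 a a1 a2] at hab
        simp at hab
      · rw [φ3 a a1 a2, φ3 b b1 b2] at hab
        exact Sum.inl_injective hab
  · intro e he e' he' hee
    rcases cls e he with ⟨p, q⟩ | ⟨a, ha, p, q⟩ | ⟨a, ha, p, q⟩ | ⟨p, q⟩ <;>
    rcases cls e' he' with ⟨p', q'⟩ | ⟨a', ha', p', q'⟩ | ⟨a', ha', p', q'⟩ | ⟨p', q'⟩ <;>
    rw [q, q'] at hee
    · rw [p, p']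
    · exact absurd hee.symm (hn1 _ (hπB _ ha') _)
    · exact absurd hee.symm (hn1 _ ha' _)
    · exact absurd hee.symm (hn2 _ p')
    · exact absurd hee (hn1 _ (hπB _ ha) _)
    · rw [p, p', hπ ha ha' (lineinj _ (hπB _ ha) _ (hπB _ ha') _ _ hee)]
    · exact absurd hee (linexy _ _)
    · exact absurd hee (linefill _ _ _)
    · exact absurd hee (hn1 _ ha _)
    · exact absurd hee.symm (linexy _ _)
    · rw [p, p', lineinj _ ha _ ha' _ _ hee]
    · exact absurd hee (linefill _ _ _)
    · exact absurd hee (hn2 _ p)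
    · exact absurd hee.symm (linefill _ _ _)
    · exact absurd hee.symm (linefill _ _ _)
    · exact fillinj _ _ hee
  · intro e he
    rcases cls e he with ⟨p, q⟩ | ⟨a, ha, p, q⟩ | ⟨a, ha, p, q⟩ | ⟨p, q⟩ <;> rw [q]
    · refine ⟨Finset.mem_insert_self _ _, ?_⟩
      intro c hc
      rw [p, Sym2.mem_iff] at hc
      rcases hc with rfl | rfl
      · rwa [φ1]
      · rwa [φ2]
    · refine ⟨Finset.mem_insert_of_mem (hmem1 _ (hπB a ha) _), ?_⟩
      intro c hc
      rw [p, Sym2.mem_iff] at hc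
      rcases hc with rfl | rfl
      · rw [φ1]; exact out_mem_lineE_self _ _ _
      · have := (hA c).1 ha
        rw [φ3 c this.1.ne' this.2, inl_mem_lineE]
        exact hT1 c ha
    · refine ⟨Finset.mem_insert_of_mem (hmem1 _ ha _), ?_⟩
      intro c hc
      rw [p, Sym2.mem_iff] at hc
      rcases hc with rfl | rfl
      · rw [φ2]; exact out_mem_lineE_self _ _ _
      · have := (hB c).1 ha
        rw [φ3 c this.2 this.1.ne', inl_mem_lineE]
        exact hT2 c
    · refine ⟨Finset.mem_insert_of_mem (hmem2 _ p), ?_⟩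
      intro c hc
      have := (hE e).1 p
      rw [φ3 c (fun h => this.2.1 (h ▸ hc)) (fun h => this.2.2 (h ▸ hc)), inl_mem_fillE]
      exact hc

open Classical in
theorem aux_free {α : Type*} [Fintype α] {s l m : ℕ} (F : SimpleGraph α)
    [DecidableRel F.Adj] (u₁ u₂ : α)
    (hne : u₁ ≠ u₂) (hadj : F.Adj u₁ u₂) (hmin : ∀ w : α, w ≠ u₁ → F.degree u₂ ≤ F.degree w)
    (A B : Finset α) (E : Finset (Sym2 α))
    (hA : ∀ a, a ∈ A ↔ F.Adj u₁ a ∧ a ≠ u₂) (hB : ∀ a, a ∈ B ↔ F.Adj u₂ a ∧ a ≠ u₁)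
    (hBc : B.card + 1 = F.degree u₂)
    (hE : ∀ e, e ∈ E ↔ e ∈ F.edgeSet ∧ u₁ ∉ e ∧ u₂ ∉ e)
    (T : α → Finset α) (hT4 : ∀ b, ∀ c ∈ T b, c = b ∨ c ∈ A) :
    ¬ F.IsBergeCopyIn (HZ s l m E B T) := by
  intro hcopy
  rcases Nat.eq_zero_or_pos B.card with h0 | hpos
  · have hB0 : B = ∅ := Finset.card_eq_zero.1 h0
    have h1 := aux_edges F _ hcopy
    have h2 : (HZ s l m E B T).card ≤ E.card := by
      unfold HZ
      rw [hB0, Finset.empty_product, Finset.image_empty, Finset.union_empty]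
      exact Finset.card_image_le
    have h3 : E.card < F.edgeFinset.card := by
      apply Finset.card_lt_card
      rw [Finset.ssubset_iff_of_subset]
      · exact ⟨s(u₁, u₂), by simpa using hadj, fun hc => ((hE _).1 hc).2.1 (by simp)⟩
      · intro e he
        simpa using ((hE e).1 he).1
    omega
  · obtain ⟨φ, f, hφ, hf, hfe⟩ := hcopy
    have hS : ∀ w, w ≠ u₁ → ∃ a, a ≠ u₁ ∧ a ≠ u₂ ∧ φ w = Sum.inl a := by
      intro w hw
      have hd := (hmin w hw).trans (aux_deg F _ φ f hf hfe w)
      have hd' : B.card < ((HZ s l m E B T).filter (fun t => φ w ∈ t)).card := by omega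
      rcases hφw : φ w with a | z | i | z
      · by_contra hcon
        have hcon' : a = u₁ ∨ a = u₂ := by
          by_contra hc
          push Not at hc
          exact hcon ⟨a, hc.1, hc.2, rfl⟩
        have : (HZ s l m E B T).filter (fun t => φ w ∈ t) = ∅ := by
          rw [Finset.filter_eq_empty_iff]
          intro t ht hm
          rw [hφw] at hm
          rcases (mem_HZ _ _ _ _).1 ht with ⟨e, he, rfl⟩ | ⟨b, hb, x, rfl⟩
          · rw [inl_mem_fillE] at hm
            have := (hE e).1 he
            rcases hcon' with rfl | rfl <;> tauto
          · rw [inl_mem_lineE] at hm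
            have hb' := (hB b).1 hb
            rcases hT4 b a hm with hab | haA
            · rcases hcon' with h | h
              · exact hb'.2 (hab.symm.trans h)
              · exact hb'.1.ne (h.symm.trans hab)
            · have := (hA a).1 haA
              rcases hcon' with h | h
              · exact this.1.ne h.symm
              · exact this.2 h
        rw [this] at hd'
        simp at hd'
      · exfalso
        have : (HZ s l m E B T).filter (fun t => φ w ∈ t) ⊆ {fillE s l m z.1} := by
          intro t ht
          rw [Finset.mem_filter, hφw] at ht
          obtain ⟨ht, hm⟩ := ht
          rcases (mem_HZ _ _ _ _).1 ht with ⟨e, he, rfl⟩ | ⟨b, hb, x, rfl⟩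
          · have := (fil_mem_fillE e z.1 z.2).1 hm
            simp [this]
          · exact absurd hm (fil_mem_lineE _ _ _ _)
        have := Finset.card_le_card this
        simp only [Finset.card_singleton] at this
        omega
      · exfalso
        have : (HZ s l m E B T).filter (fun t => φ w ∈ t) = ∅ := by
          rw [Finset.filter_eq_empty_iff]
          intro t ht hm
          rw [hφw] at hm
          rcases (mem_HZ _ _ _ _).1 ht with ⟨e, he, rfl⟩ | ⟨b, hb, x, rfl⟩
          · exact lo_mem_fillE _ _ hm
          · exact lo_mem_lineE _ _ _ _ hm
        rw [this] at hd'
        simp at hd'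
      · exfalso
        have : (HZ s l m E B T).filter (fun t => φ w ∈ t) ⊆ B.image (fun b => lineE T b z) := by
          intro t ht
          rw [Finset.mem_filter, hφw] at ht
          obtain ⟨ht, hm⟩ := ht
          rcases (mem_HZ _ _ _ _).1 ht with ⟨e, he, rfl⟩ | ⟨b, hb, x, rfl⟩
          · exact absurd hm (out_mem_fillE _ _)
          · exact Finset.mem_image.2 ⟨b, hb, (out_mem_lineE_eq _ _ _ _ hm).symm⟩
        have := (Finset.card_le_card this).trans Finset.card_image_le
        omega
    have hle : ((Finset.univ.erase u₁).image φ).card ≤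
        (((Finset.univ.erase u₁).erase u₂).image (Sum.inl : α → BV α s l m)).card := by
      apply Finset.card_le_card
      intro v hv
      obtain ⟨w, hw, rfl⟩ := Finset.mem_image.1 hv
      obtain ⟨a, h1, h2, h3⟩ := hS w (Finset.ne_of_mem_erase hw)
      rw [h3]
      exact Finset.mem_image_of_mem _ (by simp [h1, h2])
    rw [Finset.card_image_of_injective _ hφ, Finset.card_image_of_injective _ Sum.inl_injective] at hle
    have hm : u₂ ∈ Finset.univ.erase u₁ := by simp [hne.symm]
    have := Finset.card_erase_lt_of_mem hm
    omega

open Classical in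
theorem aux_main {α : Type*} [Fintype α] (F : SimpleGraph α) [DecidableRel F.Adj]
    (htypeI : ∃ u₁ u₂ : α, u₁ ≠ u₂ ∧ F.Adj u₁ u₂ ∧
      (∀ w : α, F.degree u₁ ≤ F.degree w) ∧
      (∀ w : α, w ≠ u₁ → F.degree u₂ ≤ F.degree w))
    (s l m : ℕ) (hs : 0 < s) (hm : 0 < m) :
    ∃ H : Finset (Finset (BV α s l m)), ((∀ h ∈ H, h.card = s + 2) ∧ ¬ F.IsBergeCopyIn H ∧
      ∀ h : Finset (BV α s l m), h.card = s + 2 → h ∉ H → F.IsBergeCopyIn (insert h H)) ∧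
      H.card ≤ (Fintype.card (Sym2 α) + Fintype.card α * (m * ((s + 1) * s))) +
        m * 2 ^ (Fintype.card α + Fintype.card (Sym2 α) * s + l + (s + 1) * s) := by
  obtain ⟨u₁, u₂, hne, hadj, hmin1, hmin2⟩ := htypeI
  let A := (F.neighborFinset u₁).erase u₂
  let B := (F.neighborFinset u₂).erase u₁
  let E := F.edgeFinset.filter (fun e => u₁ ∉ e ∧ u₂ ∉ e)
  have hA : ∀ a, a ∈ A ↔ F.Adj u₁ a ∧ a ≠ u₂ := by intro a; simp [A, and_comm]
  have hB : ∀ a, a ∈ B ↔ F.Adj u₂ a ∧ a ≠ u₁ := by intro a; simp [B, and_comm]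
  have hE : ∀ e, e ∈ E ↔ e ∈ F.edgeSet ∧ u₁ ∉ e ∧ u₂ ∉ e := by intro e; simp [E]
  have hAc : A.card + 1 = F.degree u₁ := by
    rw [← SimpleGraph.card_neighborFinset_eq_degree]
    exact Finset.card_erase_add_one (by simpa using hadj)
  have hBc : B.card + 1 = F.degree u₂ := by
    rw [← SimpleGraph.card_neighborFinset_eq_degree]
    exact Finset.card_erase_add_one (by simpa using hadj.symm)
  have hAB : A.card ≤ B.card := by have := hmin1 u₂; omega
  obtain ⟨π, T, hπ, hπB, hT1, hT2, hT3, hT4, hT5⟩ := aux_T A B hAB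
  let Core : Finset (BV α s l m) := Finset.univ.image Sum.inl ∪ Finset.univ.image filV ∪
    Finset.univ.image (fun i : Fin l => Sum.inr (Sum.inr (Sum.inl i)))
  let SB : Fin m → Finset (BV α s l m) := fun j => Finset.univ.image (fun p => outV (j, p))
  let Bad : Finset (Finset (BV α s l m)) :=
    Finset.univ.biUnion (fun j : Fin m => (Core ∪ SB j).powerset)
  have hcards : ∀ h ∈ HZ s l m E B T, h.card = s + 2 := by
    intro h hh
    rcases (mem_HZ _ _ _ _).1 hh with ⟨e, he, rfl⟩ | ⟨b, hb, x, rfl⟩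
    · exact card_fillE e (F.not_isDiag_of_mem_edgeSet ((hE e).1 he).1)
    · exact card_lineE T b x (hT5 b)
  have hsat : ∀ h : Finset (BV α s l m), h.card = s + 2 → h ∉ HZ s l m E B T → h ∉ Bad →
      F.IsBergeCopyIn (insert h (HZ s l m E B T)) := by
    intro h hh hn hbad
    by_cases hex : ∃ x y : Fin m × Fin (s + 1) × Fin s, x.1 ≠ y.1 ∧ outV x ∈ h ∧ outV y ∈ h
    · obtain ⟨x, y, hxy, hx, hy⟩ := hex
      exact aux_copy hs F u₁ u₂ hne A B E hA hB hE π T hπ hπB hT1 hT2 hT3 h hn x y hxy hx hy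
    · exfalso
      push Not at hex
      apply hbad
      obtain ⟨j, hj⟩ : ∃ j : Fin m, ∀ x : Fin m × Fin (s + 1) × Fin s, outV x ∈ h → x.1 = j := by
        by_cases hx : ∃ x : Fin m × Fin (s + 1) × Fin s, outV x ∈ h
        · obtain ⟨x, hx⟩ := hx
          refine ⟨x.1, fun y hy => ?_⟩
          by_contra hc
          exact hex y x hc hy hx
        · exact ⟨⟨0, hm⟩, fun y hy => absurd ⟨y, hy⟩ hx⟩
      refine Finset.mem_biUnion.2 ⟨j, Finset.mem_univ _, Finset.mem_powerset.2 ?_⟩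
      rintro (a | z | i | z) hv
      · simp [Core]
      · simp [Core]
      · simp [Core]
      · apply Finset.mem_union_right
        have := hj z hv
        exact Finset.mem_image.2 ⟨z.2, Finset.mem_univ _, by rw [← this]⟩
  obtain ⟨H, hH, hcard⟩ := aux_greedy F (s + 2) (HZ s l m E B T) Bad hcards
    (aux_free F u₁ u₂ hne hadj hmin2 A B E hA hB hBc hE T hT4) (by convert hsat)
  · refine ⟨H, hH, hcard.trans (add_le_add ?_ ?_)⟩
    · unfold HZ
      refine (Finset.card_union_le _ _).trans (add_le_add ?_ ?_)
      · exact Finset.card_image_le.trans (Finset.card_le_univ _)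
      · refine Finset.card_image_le.trans ?_
        rw [Finset.card_product]
        refine Nat.mul_le_mul (Finset.card_le_univ _) ?_
        simp
    · have : ∀ j ∈ (Finset.univ : Finset (Fin m)), ((Core ∪ SB j).powerset).card ≤
          2 ^ (Fintype.card α + Fintype.card (Sym2 α) * s + l + (s + 1) * s) := by
        intro j _
        rw [Finset.card_powerset]
        apply Nat.pow_le_pow_right (by norm_num)
        refine (Finset.card_union_le _ _).trans (add_le_add ((Finset.card_union_le _ _).trans
          (add_le_add ((Finset.card_union_le _ _).trans (add_le_add ?_ ?_)) ?_)) ?_) <;>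
        refine Finset.card_image_le.trans ?_ <;> simp
      have := Finset.card_biUnion_le_card_mul _ _ _ this
      rwa [Finset.card_univ, Fintype.card_fin] at this

/-- If `F` is of type I (it has two adjacent vertices whose degrees are the smallest and
second smallest values in the degree sequence of `F`), then for every `r ≥ 3` there is a
constant `C` with `sat_r(n, F) ≤ C·n` for all `n`. -/
theorem stmt2 {α : Type*} [Fintype α] (F : SimpleGraph α) [DecidableRel F.Adj]
    (htypeI : ∃ u₁ u₂ : α, u₁ ≠ u₂ ∧ F.Adj u₁ u₂ ∧
      (∀ w : α, F.degree u₁ ≤ F.degree w) ∧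
      (∀ w : α, w ≠ u₁ → F.degree u₂ ≤ F.degree w))
    (r : ℕ) (hr : 3 ≤ r) :
    ∃ C : ℕ, ∀ n : ℕ, ∃ H : Finset (Finset (Fin n)),
      BergeSaturated F r n H ∧ H.card ≤ C * n := by
  classical
  obtain ⟨s, rfl⟩ : ∃ s, r = s + 2 := ⟨r - 2, by omega⟩
  have hs : 0 < s := by omega
  set M := (s + 1) * s with hM
  have hMpos : 0 < M := Nat.mul_pos (by omega) hs
  set K := Fintype.card α + Fintype.card (Sym2 α) * s with hK
  set P := 2 ^ (K + M + M) with hP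
  refine ⟨2 ^ (K + M) + (Fintype.card (Sym2 α) + Fintype.card α * M + P), ?_⟩
  intro n
  by_cases hn : n < K + M
  · obtain ⟨H, hH, -⟩ := aux_greedy (V := Fin n) F (s + 2) ∅ Finset.univ (by simp) (by
      obtain ⟨u₁, u₂, _, hadj, _⟩ := htypeI
      rintro ⟨φ, f, -, -, h⟩
      exact absurd (h s(u₁, u₂) hadj).1 (by simp)) (by simp)
    refine ⟨H, hH, ?_⟩
    rcases Nat.eq_zero_or_pos n with rfl | hpos
    · have : H = ∅ := by
        rw [Finset.eq_empty_iff_forall_notMem]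
        intro h hh
        have h1 := hH.1 h hh
        have h2 := Finset.card_le_univ h
        simp only [Fintype.card_fin] at h2
        omega
      simp [this]
    · have h1 : H.card ≤ 2 ^ n := by
        refine (Finset.card_le_univ H).trans ?_
        simp
      have h2 : 2 ^ n ≤ 2 ^ (K + M) :=
        Nat.pow_le_pow_right (by norm_num) hn.le
      calc H.card ≤ 2 ^ (K + M) := h1.trans h2
        _ ≤ 2 ^ (K + M) + (Fintype.card (Sym2 α) + Fintype.card α * M + P) :=
          Nat.le_add_right _ _
        _ ≤ _ := Nat.le_mul_of_pos_right _ hpos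
  · push Not at hn
    set m := (n - K) / M with hm
    set l := (n - K) % M with hl
    have hml : M * m + l = n - K := Nat.div_add_mod _ _
    have hlM : l < M := Nat.mod_lt _ hMpos
    have hmpos : 0 < m := Nat.div_pos (by omega) hMpos
    have hmn : m * M ≤ n := by rw [mul_comm]; omega
    have hmn' : m ≤ n := (Nat.le_mul_of_pos_right m hMpos).trans hmn
    obtain ⟨H, ⟨h1, h2, h3⟩, hc⟩ := aux_main F htypeI s l m hs hmpos
    have hcardV : Fintype.card (BV α s l m) = n := by
      have : Fintype.card (BV α s l m) = K + l + m * M := by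
        simp only [BV, Fintype.card_sum, Fintype.card_prod, Fintype.card_fin, hK, hM]
        ring
      rw [this, mul_comm m M]
      omega
    refine ⟨H.image (fun t => t.image (Fintype.equivFinOfCardEq hcardV)),
      aux_transfer F (s + 2) n _ H h1 h2 h3, ?_⟩
    refine Finset.card_image_le.trans (hc.trans ?_)
    rw [← hM, ← hK]
    have e1 : 2 ^ (K + l + M) ≤ P := Nat.pow_le_pow_right (by norm_num) (by omega)
    have hn1 : 1 ≤ n := by omega
    calc Fintype.card (Sym2 α) + Fintype.card α * (m * M) + m * 2 ^ (K + l + M)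
        ≤ Fintype.card (Sym2 α) * n + Fintype.card α * (M * n) + n * P := by
          refine add_le_add (add_le_add (Nat.le_mul_of_pos_right _ hn1) ?_) ?_
          · refine Nat.mul_le_mul le_rfl ?_
            exact hmn.trans (Nat.le_mul_of_pos_left _ hMpos)
          · exact Nat.mul_le_mul hmn' e1
      _ = (Fintype.card (Sym2 α) + Fintype.card α * M + P) * n := by ring
      _ ≤ _ := Nat.mul_le_mul (Nat.le_add_left _ _) le_rfl
end

section
/- For any r, s ≥ 2 and any integers 1 ≤ k₁ ≤ k₂ ≤ … ≤ k_{s+1}, there is a constant C such that sat_r(n, K_{k₁,…,k_{s+1}}) ≤ C·n for all n, where K_{k₁,…,k_{s+1}} is the complete multipartite graph with parts of sizes k₁, …, k_{s+1}. -/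
namespace BergeSat

open SimpleGraph

/-- Pushing a Berge copy forward along an injection of vertex sets. -/
lemma copy_image {α V W : Type*} [DecidableEq W] {F : SimpleGraph α}
    {H : Finset (Finset V)} (h : F.IsBergeCopyIn H) (e : V → W) (he : Function.Injective e) :
    F.IsBergeCopyIn (H.image (Finset.image e)) := by
  obtain ⟨φ, f, hφ, hf, hH⟩ := h
  refine ⟨e ∘ φ, fun z => (f z).image e, he.comp hφ, ?_, ?_⟩
  · intro z hz z' hz' h
    exact hf hz hz' (Finset.image_injective he h)
  · intro z hz
    refine ⟨Finset.mem_image_of_mem _ (hH z hz).1, fun a ha => ?_⟩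
    exact Finset.mem_image_of_mem _ ((hH z hz).2 a ha)

lemma image_back {V W : Type*} [DecidableEq V] [DecidableEq W] (e : V ≃ W)
    (H : Finset (Finset V)) :
    (H.image (Finset.image e)).image (Finset.image e.symm) = H := by
  rw [Finset.image_image]
  have : Finset.image e.symm ∘ Finset.image e = (id : Finset V → Finset V) := by
    funext h
    simp [Finset.image_image]
  rw [this, Finset.image_id]

/-- Any Berge-`F`-free uniform hypergraph extends to a saturated one. -/
lemma exists_saturated {α : Type*} (F : SimpleGraph α) (r n : ℕ) (H0 : Finset (Finset (Fin n)))
    (hu : ∀ h ∈ H0, h.card = r) (hF : ¬ F.IsBergeCopyIn H0) :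
    ∃ H, H0 ⊆ H ∧ BergeSaturated F r n H := by
  obtain ⟨H, hle, hmax⟩ := Finite.exists_le_maximal
    (p := fun H : Finset (Finset (Fin n)) => (∀ h ∈ H, h.card = r) ∧ ¬ F.IsBergeCopyIn H)
    (a := H0) ⟨hu, hF⟩
  refine ⟨H, hle, hmax.prop.1, hmax.prop.2, fun h hr hh => ?_⟩
  by_contra hc
  have := hmax.le_of_ge (y := insert h H) ⟨?_, hc⟩ (Finset.subset_insert _ _)
  · exact hh (this (Finset.mem_insert_self _ _))
  · intro g hg
    rcases Finset.mem_insert.1 hg with rfl | hg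
    · exact hr
    · exact hmax.prop.1 g hg

/-- Finding a Berge star with leaves carrying distinct labels. -/
lemma star {V ι : Type*} [DecidableEq V] [Fintype V] [DecidableEq ι] (b : V → ι) (c : ℕ)
    (hc : ∀ i, (Finset.univ.filter (fun v => b v = i)).card ≤ c) :
    ∀ (t K : ℕ) (E : Finset (Finset V)) (S : Finset ι), S.card + t ≤ K →
      t + 2 ^ (c * K) < E.card →
      ∃ (y : Fin t → V) (h : Fin t → Finset V), Function.Injective h ∧ (∀ j, h j ∈ E) ∧
        (∀ j, y j ∈ h j) ∧ Function.Injective (fun j => b (y j)) ∧ ∀ j, b (y j) ∉ S := by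
  intro t
  induction t with
  | zero =>
    intro K E S _ _
    exact ⟨fun j => j.elim0, fun j => j.elim0, fun j => j.elim0, fun j => j.elim0,
      fun j => j.elim0, fun j => j.elim0, fun j => j.elim0⟩
  | succ t ih =>
    intro K E S hS hE
    have : ∃ h ∈ E, ∃ y ∈ h, b y ∉ S := by
      by_contra! hcon
      have hsub : E ⊆ (S.biUnion fun i => Finset.univ.filter (fun v => b v = i)).powerset := by
        intro h hh
        rw [Finset.mem_powerset]
        intro y hy
        simp [hcon h hh y hy]
      have h1 := Finset.card_le_card hsub
      rw [Finset.card_powerset] at h1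
      have h2 : (S.biUnion fun i => Finset.univ.filter (fun v => b v = i)).card ≤ S.card * c :=
        Finset.card_biUnion_le_card_mul _ _ _ (fun i _ => hc i)
      have h3 : S.card * c ≤ c * K := by nlinarith
      have h4 := Nat.pow_le_pow_right (n := 2) (by norm_num) (h2.trans h3)
      omega
    obtain ⟨h0, hh0, y0, hy0, hb0⟩ := this
    obtain ⟨y, h, hinj, hmem, hy, hbi, hbS⟩ := ih K (E.erase h0) (insert (b y0) S)
      (by rw [Finset.card_insert_of_notMem hb0]; omega)
      (by rw [Finset.card_erase_of_mem hh0]; omega)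
    refine ⟨Fin.cons y0 y, Fin.cons h0 h, ?_, ?_, ?_, ?_, ?_⟩
    · rw [Fin.cons_injective_iff]
      refine ⟨?_, hinj⟩
      rintro ⟨j, rfl⟩
      exact (Finset.mem_erase.1 (hmem j)).1 rfl
    · intro j
      refine Fin.cases ?_ (fun j => ?_) j
      · simpa using hh0
      · simpa using (Finset.mem_erase.1 (hmem j)).2
    · intro j
      refine Fin.cases ?_ (fun j => ?_) j
      · simpa using hy0
      · simpa using hy j
    · have : (fun j => b ((Fin.cons y0 y : Fin (t+1) → V) j)) =
          (Fin.cons (b y0) (fun j => b (y j)) : Fin (t+1) → ι) := by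
        funext j
        refine Fin.cases ?_ (fun j => ?_) j <;> simp
      rw [this, Fin.cons_injective_iff]
      refine ⟨?_, hbi⟩
      rintro ⟨j, hj⟩
      exact hbS j (by simp [← hj])
    · intro j
      refine Fin.cases ?_ (fun j => ?_) j
      · simpa using hb0
      · have := hbS j
        simp only [Finset.mem_insert, not_or] at this
        simpa using this.2

/-- The vertex set: a core of `q` vertices, pads for each pair, leftovers, and blocks. -/
abbrev W (q r l M : ℕ) : Type :=
  (Fin q ⊕ (Sym2 (Fin q) × Fin (r - 2)) ⊕ Fin l) ⊕ (Fin M × Fin (r - 1))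

variable {q r l M : ℕ}

instance instDecW : DecidableEq (W q r l M) := inferInstance

instance instDecFW : DecidableEq (Finset (W q r l M)) := Finset.decidableEq

/-- core vertex -/
abbrev cv (i : Fin q) : W q r l M := Sum.inl (Sum.inl i)
/-- pad vertex -/
abbrev pv (z : Sym2 (Fin q)) (j : Fin (r - 2)) : W q r l M := Sum.inl (Sum.inr (Sum.inl (z, j)))
/-- block vertex -/
abbrev bv (b : Fin M) (j : Fin (r - 1)) : W q r l M := Sum.inr (b, j)

/-- hyperedge joining a core vertex to a block -/
def eE (i : Fin q) (b : Fin M) : Finset (W q r l M) :=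
  insert (cv i) (Finset.univ.image (bv b))

/-- hyperedge joining two core vertices -/
def gE (z : Sym2 (Fin q)) : Finset (W q r l M) :=
  z.toFinset.image cv ∪ Finset.univ.image (pv z)

/-- the base hypergraph -/
def H0 (q r l M : ℕ) : Finset (Finset (W q r l M)) :=
  (Finset.univ : Finset (Fin q × Fin M)).image (fun x => eE x.1 x.2) ∪
    (Finset.univ.filter (fun z : Sym2 (Fin q) => ¬ z.IsDiag)).image gE

lemma mem_H0 {h : Finset (W q r l M)} :
    h ∈ H0 q r l M ↔ (∃ i b, eE i b = h) ∨ ∃ z : Sym2 (Fin q), ¬ z.IsDiag ∧ gE z = h := by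
  simp [H0]

lemma cv_mem_eE {i j : Fin q} {b : Fin M} : (cv i : W q r l M) ∈ eE j b ↔ i = j := by
  simp [eE]
lemma bv_mem_eE {j : Fin q} {b b' : Fin M} {x} : (bv b x : W q r l M) ∈ eE j b' ↔ b' = b := by
  simp [eE]
lemma cv_mem_gE {i : Fin q} {z} : (cv i : W q r l M) ∈ gE z ↔ i ∈ z := by
  simp [gE]
lemma bv_mem_gE {b : Fin M} {x} {z : Sym2 (Fin q)} : ¬ (bv b x : W q r l M) ∈ gE z := by
  simp [gE]

lemma H0_uniform (hr : 2 ≤ r) : ∀ h ∈ H0 q r l M, h.card = r := by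
  intro h hh
  rcases mem_H0.1 hh with ⟨i, b, rfl⟩ | ⟨z, hz, rfl⟩
  · rw [eE, Finset.card_insert_of_notMem (by simp), Finset.card_image_of_injective]
    · simp; omega
    · intro x y h; simpa using h
  · rw [gE, Finset.card_union_of_disjoint, Finset.card_image_of_injective,
      Finset.card_image_of_injective, Sym2.card_toFinset_of_not_isDiag _ hz]
    · simp; omega
    · intro x y h; simpa using h
    · intro x y h; simpa using h
    · rw [Finset.disjoint_left]; simp

lemma eE_inj (hr : 2 ≤ r) {i j : Fin q} {b b' : Fin M}
    (h : (eE i b : Finset (W q r l M)) = eE j b') : i = j ∧ b = b' := by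
  constructor
  · exact cv_mem_eE.1 (h ▸ cv_mem_eE.2 rfl : (cv i : W q r l M) ∈ eE j b')
  · exact (bv_mem_eE.1 (h ▸ bv_mem_eE.2 rfl :
      (bv b ⟨0, by omega⟩ : W q r l M) ∈ eE j b')).symm

lemma gE_inj {z z' : Sym2 (Fin q)} (h : (gE z : Finset (W q r l M)) = gE z') : z = z' := by
  apply Sym2.ext
  intro i
  rw [← cv_mem_gE (r := r) (l := l) (M := M), h, cv_mem_gE]

lemma eE_ne_gE (hr : 2 ≤ r) {i : Fin q} {b : Fin M} {z} :
    (eE i b : Finset (W q r l M)) ≠ gE z := by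
  intro h
  exact bv_mem_gE (h ▸ bv_mem_eE.2 rfl : (bv b ⟨0, by omega⟩ : W q r l M) ∈ gE z)

/-- Vertices outside the core have small degree. -/
lemma H0_degree (hq : 1 ≤ q) (w : W q r l M) (hw : ∀ i, w ≠ cv i) :
    ((H0 q r l M).filter (fun h => w ∈ h)).card ≤ q := by
  rcases w with (i | ⟨z, j⟩ | j) | ⟨b, j⟩
  · exact absurd rfl (hw i)
  · refine le_trans (Finset.card_le_card (t := {gE z}) ?_) (by simpa using hq)
    intro h hh
    rw [Finset.mem_filter, mem_H0] at hh
    rcases hh with ⟨⟨i, b, rfl⟩ | ⟨z', hz, rfl⟩, hm⟩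
    · simp [eE] at hm
    · have : z' = z := by simpa [gE] using hm
      simp [this]
  · refine le_trans (Finset.card_le_card (t := ∅) ?_) (by simp)
    intro h hh
    rw [Finset.mem_filter, mem_H0] at hh
    rcases hh with ⟨⟨i, b, rfl⟩ | ⟨z', hz, rfl⟩, hm⟩
    · simp [eE] at hm
    · simp [gE] at hm
  · refine le_trans (Finset.card_le_card
      (t := (Finset.univ : Finset (Fin q)).image (fun i => eE i b)) ?_)
      (Finset.card_image_le.trans (by simp))
    intro h hh
    rw [Finset.mem_filter, mem_H0] at hh
    rcases hh with ⟨⟨i, b', rfl⟩ | ⟨z', hz, rfl⟩, hm⟩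
    · have : b' = b := bv_mem_eE.1 hm
      simp [this]
    · exact absurd hm bv_mem_gE

lemma H0_free {α : Type*} [Fintype α] [DecidableEq α] [Nonempty α] (F : SimpleGraph α)
    [DecidableRel F.Adj] (hq : 1 ≤ q) (hdeg : ∀ v, q + 1 ≤ F.degree v) :
    ¬ F.IsBergeCopyIn (H0 q r l M) := by
  rintro ⟨φ, f, hφ, hf, hH⟩
  have key : ∀ v, ∃ i, φ v = cv i := by
    intro v
    by_contra! hcon
    have h1 := H0_degree hq (φ v) hcon
    have h2 : F.degree v ≤ ((H0 q r l M).filter (fun h => φ v ∈ h)).card := by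
      rw [← F.card_neighborFinset_eq_degree]
      apply Finset.card_le_card_of_injOn (fun u => f s(v, u))
      · intro u hu
        have hu' : s(v, u) ∈ F.edgeSet := by simpa using hu
        have := hH _ hu'
        simp only [Finset.coe_filter, Set.mem_ofPred_eq]
        exact ⟨this.1, this.2 v (by simp)⟩
      · intro u hu u' hu' h
        have := hf (by simpa using hu) (by simpa using hu') h
        exact Sym2.congr_right.1 this
    have := hdeg v
    omega
  choose g hg using key
  have hgi : Function.Injective g := fun u v h => hφ (by rw [hg, hg, h])
  have h1 := Fintype.card_le_of_injective g hgi
  obtain ⟨v⟩ := ‹Nonempty α›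
  have h2 := F.degree_lt_card_verts v
  have := hdeg v
  simp at h1
  omega

/-- Hyperedge assigned to a pair of vertices of the join graph. -/
def ff {t : ℕ} (b : Option (Fin t) → Fin M) (h : Fin t → Finset (W q r l M)) :
    Fin q ⊕ Option (Fin t) → Fin q ⊕ Option (Fin t) → Finset (W q r l M)
  | .inl i, .inl j => gE s(i, j)
  | .inl i, .inr z => eE i (b z)
  | .inr z, .inl i => eE i (b z)
  | .inr none, .inr (some j) => h j
  | .inr (some j), .inr none => h j
  | .inr none, .inr none => ∅
  | .inr (some _), .inr (some _) => ∅

lemma ff_symm {t : ℕ} (b : Option (Fin t) → Fin M) (h : Fin t → Finset (W q r l M)) (u v) :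
    ff b h u v = ff b h v u := by
  rcases u with i | (_ | i) <;> rcases v with j | (_ | j) <;> simp [ff, Sym2.eq_swap]

/-- Edges of the join graph, classified. -/
def Good {t : ℕ} (z : Sym2 (Fin q ⊕ Option (Fin t))) : Prop :=
  (∃ i j, i ≠ j ∧ z = s(.inl i, .inl j)) ∨ (∃ i o, z = s(.inl i, .inr o)) ∨
    ∃ j, z = s(.inr none, .inr (some j))

lemma good_of {t : ℕ} (u v : Fin q ⊕ Option (Fin t)) (huv : u ≠ v)
    (hn : ¬ ∃ j j', u = .inr (some j) ∧ v = .inr (some j')) : Good s(u, v) := by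
  rcases u with i | (_ | i) <;> rcases v with j | (_ | j)
  · exact Or.inl ⟨i, j, by simpa using huv, rfl⟩
  · exact Or.inr (Or.inl ⟨i, _, rfl⟩)
  · exact Or.inr (Or.inl ⟨i, _, rfl⟩)
  · exact Or.inr (Or.inl ⟨j, _, Sym2.eq_swap⟩)
  · exact absurd rfl huv
  · exact Or.inr (Or.inr ⟨j, rfl⟩)
  · exact Or.inr (Or.inl ⟨j, _, Sym2.eq_swap⟩)
  · exact Or.inr (Or.inr ⟨i, Sym2.eq_swap⟩)
  · exact absurd ⟨i, j, rfl, rfl⟩ hn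

/-- A star with leaves in distinct blocks, together with the base, gives a Berge copy. -/
lemma copy_of_star {α : Type*} (F : SimpleGraph α) (hr : 2 ≤ r) {t : ℕ}
    (ψ : α → Fin q ⊕ Option (Fin t)) (hψ : Function.Injective ψ)
    (hF : ∀ u v, F.Adj u v → ¬ ∃ j j', ψ u = .inr (some j) ∧ ψ v = .inr (some j'))
    (H : Finset (Finset (W q r l M))) (hH : H0 q r l M ⊆ H)
    (b : Option (Fin t) → Fin M) (x : Option (Fin t) → Fin (r - 1)) (hb : Function.Injective b)
    (h : Fin t → Finset (W q r l M)) (hinj : Function.Injective h)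
    (hhH : ∀ j, h j ∈ H) (hhH0 : ∀ j, h j ∉ H0 q r l M)
    (hx : ∀ j, bv (b none) (x none) ∈ h j) (hy : ∀ j, bv (b (some j)) (x (some j)) ∈ h j) :
    F.IsBergeCopyIn H := by
  let G : Sym2 (Fin q ⊕ Option (Fin t)) → Finset (W q r l M) :=
    Sym2.lift ⟨ff b h, ff_symm b h⟩
  let Φ : Fin q ⊕ Option (Fin t) → W q r l M := Sum.elim cv (fun o => bv (b o) (x o))
  have hgood : ∀ e ∈ F.edgeSet, Good (e.map ψ) := by
    intro e
    induction e using Sym2.ind with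
    | _ u v =>
      intro he
      rw [Sym2.map_mk]
      exact good_of _ _ (fun hh => F.ne_of_adj he (hψ hh)) (hF u v he)
  have heH : ∀ i b', (eE i b' : Finset (W q r l M)) ∈ H0 q r l M :=
    fun i b' => mem_H0.2 (Or.inl ⟨i, b', rfl⟩)
  have hgH : ∀ i j, i ≠ j → (gE s(i, j) : Finset (W q r l M)) ∈ H0 q r l M :=
    fun i j hij => mem_H0.2 (Or.inr ⟨_, by simpa using hij, rfl⟩)
  have hGinj : ∀ z z', Good z → Good z' → G z = G z' → z = z' := by
    rintro z z' (⟨i, j, hij, rfl⟩ | ⟨i, o, rfl⟩ | ⟨j, rfl⟩)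
      (⟨i', j', hij', rfl⟩ | ⟨i', o', rfl⟩ | ⟨j', rfl⟩) hG <;>
      simp only [G, Sym2.lift_mk, ff] at hG
    · have := gE_inj hG
      simpa using this
    · exact absurd hG.symm (eE_ne_gE hr)
    · exact absurd (hG ▸ hgH i j hij) (hhH0 _)
    · exact absurd hG (eE_ne_gE hr)
    · obtain ⟨rfl, h2⟩ := eE_inj hr hG
      rw [hb h2]
    · exact absurd (hG ▸ heH i _) (hhH0 _)
    · exact absurd (hG ▸ hgH i' j' hij') (hhH0 _)
    · exact absurd (hG ▸ heH i' _) (hhH0 _)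
    · rw [hinj hG]
  have hGH : ∀ z, Good z → G z ∈ H ∧ ∀ a ∈ z, Φ a ∈ G z := by
    rintro z (⟨i, j, hij, rfl⟩ | ⟨i, o, rfl⟩ | ⟨j, rfl⟩) <;>
      simp only [G, Sym2.lift_mk, ff]
    · refine ⟨hH (hgH i j hij), fun a ha => ?_⟩
      rcases Sym2.mem_iff.1 ha with rfl | rfl
      · exact cv_mem_gE.2 (by simp)
      · exact cv_mem_gE.2 (by simp)
    · refine ⟨hH (heH i _), fun a ha => ?_⟩
      rcases Sym2.mem_iff.1 ha with rfl | rfl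
      · exact cv_mem_eE.2 rfl
      · exact bv_mem_eE.2 rfl
    · refine ⟨hhH j, fun a ha => ?_⟩
      rcases Sym2.mem_iff.1 ha with rfl | rfl
      · exact hx j
      · exact hy j
  have hΦ : Function.Injective Φ := by
    intro u v huv
    rcases u with i | o <;> rcases v with i' | o'
    · simpa [Φ] using huv
    · simp [Φ] at huv
    · simp [Φ] at huv
    · have : b o = b o' := by
        simp only [Φ, Sum.elim_inr, Sum.inr.injEq, Prod.mk.injEq] at huv
        exact huv.1
      rw [hb this]
  refine ⟨Φ ∘ ψ, fun e => G (e.map ψ), hΦ.comp hψ, ?_, ?_⟩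
  · intro e he e' he' hee
    exact Sym2.map.injective hψ (hGinj _ _ (hgood e he) (hgood e' he') hee)
  · intro e he
    obtain ⟨h1, h2⟩ := hGH _ (hgood e he)
    exact ⟨h1, fun a ha => h2 _ (Sym2.mem_map.2 ⟨a, ha, rfl⟩)⟩

/-- block label -/
def lab : W q r l M → Option (Fin M)
  | .inl _ => none
  | .inr p => some p.1

/-- number of non-block vertices -/
def qq (q r : ℕ) : ℕ := q + Fintype.card (Sym2 (Fin q)) * (r - 2)

lemma lab_fiber (hl : l ≤ r) (o : Option (Fin M)) :
    (Finset.univ.filter (fun v : W q r l M => lab v = o)).card ≤ qq q r + r + r := by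
  rcases o with _ | b
  · refine le_trans (Finset.card_le_card (t := Finset.univ.image Sum.inl) ?_) ?_
    · intro v hv
      rcases v with v | v
      · simp
      · have hv' := (Finset.mem_filter.1 hv).2
        simp [lab] at hv'
    · refine Finset.card_image_le.trans ?_
      simp [qq, Fintype.card_sum, Fintype.card_prod]
      omega
  · refine le_trans (Finset.card_le_card (t := Finset.univ.image (bv b)) ?_) ?_
    · intro v hv
      rcases v with v | ⟨b', j⟩
      · have hv' := (Finset.mem_filter.1 hv).2
        simp [lab] at hv'
      · have : b' = b := by
          have := (Finset.mem_filter.1 hv).2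
          simpa [lab] using this
        simp [this]
    · refine Finset.card_image_le.trans ?_
      simp
      omega

/-- The degree bound for new hyperedges. -/
lemma new_degree {α : Type*} (F : SimpleGraph α) (hr : 2 ≤ r) (hl : l ≤ r) {t : ℕ}
    (ψ : α → Fin q ⊕ Option (Fin t)) (hψ : Function.Injective ψ)
    (hF : ∀ u v, F.Adj u v → ¬ ∃ j j', ψ u = .inr (some j) ∧ ψ v = .inr (some j'))
    (H : Finset (Finset (W q r l M))) (hH : H0 q r l M ⊆ H) (hfree : ¬ F.IsBergeCopyIn H)
    (p : Fin M × Fin (r - 1)) :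
    ((H \ H0 q r l M).filter (fun h => (Sum.inr p : W q r l M) ∈ h)).card
      ≤ t + 2 ^ ((qq q r + r + r) * (t + 2)) := by
  by_contra! hcon
  obtain ⟨y, h, hinj, hmem, hy, hbi, hbS⟩ := star (lab : W q r l M → Option (Fin M)) _
    (lab_fiber hl) t (t + 2) _ {none, some p.1}
    (by have := Finset.card_le_two (a := (none : Option (Fin M))) (b := some p.1); omega) hcon
  have hyb : ∀ j, ∃ p', y j = Sum.inr p' := by
    intro j
    rcases hj : y j with v | v
    · exact absurd (hbS j) (by simp [hj, lab])
    · exact ⟨v, rfl⟩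
  choose p' hp' using hyb
  apply hfree
  refine copy_of_star F hr ψ hψ hF H hH (fun o => (o.elim p p').1) (fun o => (o.elim p p').2)
    ?_ h hinj ?_ ?_ ?_ ?_
  · intro o o' hoo
    have hne : ∀ j, p.1 ≠ (p' j).1 := by
      intro j hj
      apply hbS j
      simp [hp', lab, hj]
    rcases o with _ | j <;> rcases o' with _ | j'
    · rfl
    · exact absurd hoo (hne j')
    · exact absurd hoo.symm (hne j)
    · have : j = j' := hbi (by simpa [hp', lab] using hoo)
      rw [this]
  · intro j
    exact (Finset.mem_sdiff.1 (Finset.mem_filter.1 (hmem j)).1).1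
  · intro j
    exact (Finset.mem_sdiff.1 (Finset.mem_filter.1 (hmem j)).1).2
  · intro j
    exact (Finset.mem_filter.1 (hmem j)).2
  · intro j
    have := hy j
    rw [hp'] at this
    exact this

lemma total_bound {α : Type*} (F : SimpleGraph α) (hr : 2 ≤ r) (hl : l ≤ r) {t : ℕ}
    (ψ : α → Fin q ⊕ Option (Fin t)) (hψ : Function.Injective ψ)
    (hF : ∀ u v, F.Adj u v → ¬ ∃ j j', ψ u = .inr (some j) ∧ ψ v = .inr (some j'))
    (H : Finset (Finset (W q r l M))) (hH : H0 q r l M ⊆ H) (hfree : ¬ F.IsBergeCopyIn H) :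
    H.card ≤ (q * M + Fintype.card (Sym2 (Fin q))) + (2 ^ (qq q r + r + r) +
      M * (r - 1) * (t + 2 ^ ((qq q r + r + r) * (t + 2)))) := by
  have hsub : H ⊆ H0 q r l M ∪ ((Finset.univ.filter
      (fun v : W q r l M => lab v = none)).powerset ∪
      (Finset.univ : Finset (Fin M × Fin (r - 1))).biUnion (fun p =>
        (H \ H0 q r l M).filter (fun h => (Sum.inr p : W q r l M) ∈ h))) := by
    intro h hh
    by_cases h0 : h ∈ H0 q r l M
    · exact Finset.mem_union_left _ h0
    · apply Finset.mem_union_right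
      by_cases h1 : ∃ p, (Sum.inr p : W q r l M) ∈ h
      · obtain ⟨p, hp⟩ := h1
        apply Finset.mem_union_right
        simp only [Finset.mem_biUnion, Finset.mem_univ, true_and, Finset.mem_filter,
          Finset.mem_sdiff]
        exact ⟨p, ⟨hh, h0⟩, hp⟩
      · apply Finset.mem_union_left
        rw [Finset.mem_powerset]
        intro v hv
        rcases v with v | v
        · exact Finset.mem_filter.2 ⟨Finset.mem_univ _, rfl⟩
        · exact absurd ⟨v, hv⟩ h1
  refine (Finset.card_le_card hsub).trans ((Finset.card_union_le _ _).trans ?_)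
  refine Nat.add_le_add ?_ ((Finset.card_union_le _ _).trans (Nat.add_le_add ?_ ?_))
  · refine (Finset.card_union_le _ _).trans (Nat.add_le_add ?_ ?_)
    · exact Finset.card_image_le.trans (by simp)
    · exact Finset.card_image_le.trans (Finset.card_le_univ _)
  · rw [Finset.card_powerset]
    exact Nat.pow_le_pow_right (by norm_num) (lab_fiber hl none)
  · refine (Finset.card_biUnion_le_card_mul _ _ _
      (fun p _ => new_degree F hr hl ψ hψ hF H hH hfree p)).trans ?_
    simp

theorem main {α : Type*} [Fintype α] [DecidableEq α] [Nonempty α] (F : SimpleGraph α)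
    [DecidableRel F.Adj] (q r t : ℕ) (hq : 1 ≤ q) (hr : 2 ≤ r)
    (hdeg : ∀ v, q + 1 ≤ F.degree v)
    (ψ : α → Fin q ⊕ Option (Fin t)) (hψ : Function.Injective ψ)
    (hF : ∀ u v, F.Adj u v → ¬ ∃ j j', ψ u = .inr (some j) ∧ ψ v = .inr (some j')) :
    ∃ C : ℕ, ∀ n : ℕ, ∃ H : Finset (Finset (Fin n)), BergeSaturated F r n H ∧
      H.card ≤ C * n := by
  obtain ⟨D, hD⟩ : ∃ D, D = t + 2 ^ ((qq q r + r + r) * (t + 2)) := ⟨_, rfl⟩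
  obtain ⟨T, hT⟩ : ∃ T, T = Fintype.card (Sym2 (Fin q)) := ⟨_, rfl⟩
  refine ⟨2 ^ (2 ^ qq q r) + (q + T + 2 ^ (qq q r + r + r) + D), fun n => ?_⟩
  by_cases hn : n < qq q r
  · obtain ⟨H, -, hH⟩ := exists_saturated F r n ∅ (by simp) (by
      rintro ⟨φ, f, hφ, hf, h⟩
      obtain ⟨v⟩ := ‹Nonempty α›
      have h1 : 0 < F.degree v := by have := hdeg v; omega
      obtain ⟨u, hu⟩ := (F.degree_pos_iff_exists_adj v).1 h1
      have := (h s(v, u) hu).1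
      simp at this)
    refine ⟨H, hH, ?_⟩
    rcases Nat.eq_zero_or_pos n with rfl | hpos
    · have : H = ∅ := by
        apply Finset.eq_empty_of_forall_notMem
        intro h hh
        have h1 := hH.1 h hh
        have h2 := Finset.card_le_univ h
        simp at h2
        simp [h2] at h1
        omega
      simp [this]
    · have h1 : H.card ≤ 2 ^ n := by
        have := Finset.card_le_univ H
        simpa using this
      have h2 : 2 ^ n ≤ 2 ^ (2 ^ qq q r) := 
        Nat.pow_le_pow_right (by norm_num) (hn.le.trans Nat.lt_two_pow_self.le)
      have h3 := Nat.le_mul_of_pos_right (2 ^ (2 ^ qq q r)) hpos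
      have h4 := Nat.zero_le ((q + T + 2 ^ (qq q r + r + r) + D) * n)
      rw [add_mul]
      omega
  · push Not at hn
    obtain ⟨M, hM⟩ : ∃ M, M = (n - qq q r) / (r - 1) := ⟨_, rfl⟩
    obtain ⟨l, hl⟩ : ∃ l, l = (n - qq q r) % (r - 1) := ⟨_, rfl⟩
    have hlr : l ≤ r := by
      have := Nat.mod_lt (n - qq q r) (show r - 1 > 0 by omega)
      omega
    have hdm := Nat.mod_add_div (n - qq q r) (r - 1)
    rw [← hM, ← hl] at hdm
    have hcard : Fintype.card (W q r l M) = n := by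
      simp only [Fintype.card_sum, Fintype.card_prod, Fintype.card_fin]
      have : qq q r = q + Fintype.card (Sym2 (Fin q)) * (r - 2) := rfl
      rw [mul_comm M]
      omega
    let e : W q r l M ≃ Fin n := Fintype.equivFinOfCardEq hcard
    have hback : ∀ H : Finset (Finset (W q r l M)),
        (H.image (Finset.image e)).image (Finset.image e.symm) = H := by
      intro H
      exact image_back e H
    obtain ⟨H, hsub, hH⟩ := exists_saturated F r n ((H0 q r l M).image (Finset.image e))
      (by
        intro h hh
        obtain ⟨h', hh', rfl⟩ := Finset.mem_image.1 hh
        rw [Finset.card_image_of_injective _ e.injective]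
        exact H0_uniform hr h' hh')
      (by
        intro hc
        have := copy_image hc e.symm e.symm.injective
        rw [hback] at this
        exact H0_free F hq hdeg this)
    refine ⟨H, hH, ?_⟩
    have hb := total_bound F hr hlr ψ hψ hF (H.image (Finset.image e.symm))
      (by rw [← hback (H0 q r l M)]; exact Finset.image_subset_image hsub)
      (by
        intro hc
        have := copy_image hc e e.injective
        apply hH.2.1
        have hid := image_back e.symm H
        rw [Equiv.symm_symm] at hid
        rwa [hid] at this)
    rw [Finset.card_image_of_injective _ (Finset.image_injective e.symm.injective), ← hD, ← hT]
      at hb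
    have hqn : q ≤ n := le_trans (by unfold qq; omega) hn
    have h1n : 1 ≤ n := hq.trans hqn
    have hMr : M * (r - 1) ≤ n := by rw [mul_comm]; omega
    have hMn : M ≤ n := le_trans (Nat.le_mul_of_pos_right M (by omega)) hMr
    have a1 : q * M ≤ q * n := Nat.mul_le_mul_left _ hMn
    have a2 : M * (r - 1) * D ≤ n * D := Nat.mul_le_mul_right _ hMr
    have a3 : T ≤ T * n := Nat.le_mul_of_pos_right _ h1n
    have a4 := Nat.le_mul_of_pos_right (2 ^ (qq q r + r + r)) h1n
    have a5 := Nat.zero_le (2 ^ (2 ^ qq q r) * n)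
    linarith

end BergeSat

/-- For any `r, s ≥ 2` and nondecreasing part sizes `1 ≤ k 0 ≤ … ≤ k s`, the Berge
saturation number of the complete multipartite graph with these `s+1` part sizes is at
most `C·n` for some constant `C`. -/
theorem stmt4 (r s : ℕ) (hr : 2 ≤ r) (hs : 2 ≤ s) (k : Fin (s + 1) → ℕ)
    (hk1 : 1 ≤ k 0) (hmono : Monotone k) :
    ∃ C : ℕ, ∀ n : ℕ, ∃ H : Finset (Finset (Fin n)),
      BergeSaturated (SimpleGraph.completeMultipartiteGraph fun i => Fin (k i)) r n H ∧
      H.card ≤ C * n := by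
  classical
  have hkpos : ∀ i, 1 ≤ k i := fun i => hk1.trans (hmono (Fin.zero_le i))
  let α := Σ i : Fin (s + 1), Fin (k i)
  let L := Fin.last s
  have hcardsum : ∀ i : Fin (s + 1), Fintype.card {u : α // u.1 = i} = k i := by
    intro i
    rw [Fintype.card_congr (Equiv.sigmaSubtype (β := fun i => Fin (k i)) i)]
    simp
  have hcompl : ∀ i : Fin (s + 1),
      Fintype.card {u : α // ¬ u.1 = i} = Fintype.card α - k i := by
    intro i
    rw [Fintype.card_subtype_compl, hcardsum]
  have h01 : (⟨0, by omega⟩ : Fin (s + 1)) ≠ L := by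
    intro h; have := congrArg Fin.val h; simp [L] at this; omega
  have h11 : (⟨1, by omega⟩ : Fin (s + 1)) ≠ L := by
    intro h; have := congrArg Fin.val h; simp [L] at this; omega
  have hp : 1 < Fintype.card {u : α // ¬ u.1 = L} := by
    rw [Fintype.one_lt_card_iff]
    refine ⟨⟨⟨⟨0, by omega⟩, ⟨0, hkpos _⟩⟩, h01⟩, ⟨⟨⟨1, by omega⟩, ⟨0, hkpos _⟩⟩, h11⟩, ?_⟩
    intro h
    have := congrArg (fun u => u.1.1.val) h
    simp at this
  obtain ⟨q, hq⟩ : ∃ q, Fintype.card {u : α // ¬ u.1 = L} = q + 1 := ⟨_, (Nat.succ_pred (by omega)).symm⟩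
  have e1 : {u : α // ¬ u.1 = L} ≃ Option (Fin q) :=
    Fintype.equivOfCardEq (by rw [hq]; simp)
  have e2 : {u : α // u.1 = L} ≃ Fin (k L) := Fintype.equivOfCardEq (by rw [hcardsum]; simp)
  let g : Option (Fin q) → Fin q ⊕ Option (Fin (k L)) := fun o => o.elim (.inr none) .inl
  have hg : Function.Injective g := by
    intro o o' h
    rcases o with _ | i <;> rcases o' with _ | j <;> simp [g] at h ⊢
    exact h
  have hgn : ∀ o j, g o ≠ .inr (some j) := by
    intro o j
    rcases o with _ | i <;> simp [g]
  have : Nonempty α := ⟨⟨0, ⟨0, hk1⟩⟩⟩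
  let ψ : α → Fin q ⊕ Option (Fin (k L)) := fun u =>
    if h : u.1 = L then .inr (some (e2 ⟨u, h⟩)) else g (e1 ⟨u, h⟩)
  refine BergeSat.main (α := α) _ q r (k L) (by omega) hr ?_ ψ ?_ ?_
  · intro v
    rw [← hq, ← SimpleGraph.card_neighborFinset_eq_degree]
    have : (SimpleGraph.completeMultipartiteGraph fun i => Fin (k i)).neighborFinset v
        = Finset.univ.filter (fun u : α => ¬ u.1 = v.1) := by
      ext u
      simp [α, eq_comm]
    rw [this, ← Fintype.card_subtype, hcompl, hcompl]
    exact Nat.sub_le_sub_left (hmono (Fin.le_last _)) _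
  · intro u v huv
    by_cases hu : u.1 = L <;> by_cases hv : v.1 = L <;> simp only [ψ, hu, hv, dif_pos, dif_neg, not_false_eq_true] at huv
    · simpa using huv
    · exact absurd huv.symm (hgn _ _)
    · exact absurd huv (hgn _ _)
    · simpa using e1.injective (hg huv)
  · rintro u v huv ⟨j, j', h1, h2⟩
    have hu : u.1 = L := by
      by_contra hu
      simp only [ψ, hu, dif_neg, not_false_eq_true] at h1
      exact hgn _ _ h1
    have hv : v.1 = L := by
      by_contra hv
      simp only [ψ, hv, dif_neg, not_false_eq_true] at h2
      exact hgn _ _ h2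
    exact huv (hu.trans hv.symm)
end

section
/- Let F be a connected graph that is not a star and contains a cut-edge (u,w), and suppose r ≥ e(F) where e(F) is the number of edges of F. Then there is a constant C such that sat_r(n, F) ≤ C·n for all n. -/
theorem SimpleGraph.Connected.crossing {α : Type*} {F : SimpleGraph α} (hF : F.Connected)
    (S : Set α) {a b : α} (ha : a ∈ S) (hb : b ∉ S) :
    ∃ p q, F.Adj p q ∧ p ∈ S ∧ q ∉ S := by
  obtain ⟨p⟩ := hF a b
  obtain ⟨d, hd, h1, h2⟩ := p.exists_boundary_dart S ha hb
  exact ⟨d.fst, d.snd, d.adj, h1, h2⟩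

theorem three_le_edges {α : Type*} [Fintype α] (F : SimpleGraph α)
    (hconn : F.Connected)
    (hnotstar : ¬ ∃ c : α, ∀ e ∈ F.edgeSet, c ∈ e)
    (u w : α) (huw : F.Adj u w) : 3 ≤ F.edgeSet.ncard := by
  classical
  push Not at hnotstar
  by_contra hlt
  have key : ∀ a b c : Sym2 α, a ∈ F.edgeSet → b ∈ F.edgeSet → c ∈ F.edgeSet →
      a ≠ b → a ≠ c → b ≠ c → False := by
    intro a b c ha hb hc hab hac hbc
    apply hlt
    have h3 : ({a, b, c} : Set (Sym2 α)).ncard = 3 := Set.ncard_eq_three.2 ⟨a, b, c, hab, hac, hbc, rfl⟩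
    rw [← h3]
    apply Set.ncard_le_ncard _ (Set.toFinite _)
    rintro x (rfl | rfl | rfl) <;> assumption
  obtain ⟨e1, he1, hu1⟩ := hnotstar u
  obtain ⟨e2, he2, hw2⟩ := hnotstar w
  have n1 : s(u, w) ≠ e1 := by rintro rfl; simp at hu1
  have n2 : s(u, w) ≠ e2 := by rintro rfl; simp at hw2
  have h12 : e1 = e2 := by
    by_contra h
    exact key _ _ _ huw he1 he2 n1 n2 h
  subst h12
  induction e1 with
  | h a b =>
    obtain ⟨p, q, hpq, hp, hq⟩ := hconn.crossing {u, w} (a := u) (b := a) (by simp)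
      (by simp at hu1 hw2 ⊢; grind)
    refine key _ _ s(p, q) huw he1 hpq n1 ?_ ?_
    · simp at hp hq ⊢; grind
    · simp at hp hq hu1 hw2 ⊢; grind

theorem emb_lemma {α V : Type*} [Fintype α] [DecidableEq V] (F : SimpleGraph α)
    (hconn : F.Connected)
    (hnotstar : ¬ ∃ c : α, ∀ e ∈ F.edgeSet, c ∈ e)
    (u w : α) (huw : F.Adj u w) (S : Set α) (huS : u ∈ S) (hwS : w ∉ S)
    (hsep : ∀ a b, F.Adj a b → a ∈ S → b ∉ S → a = u ∧ b = w)
    (Q X : Finset V) (hX : X.card + 1 = F.edgeSet.ncard)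
    (hQ : F.edgeSet.ncard + 1 ≤ Q.card) (x : V) (hx : x ∈ Q) :
    ∃ (φ : α → V) (g : Sym2 α → V), φ u = x ∧ Set.InjOn φ S ∧ (∀ a ∈ S, φ a ∈ Q) ∧
      Set.InjOn g {e | e ∈ F.edgeSet ∧ ∀ a ∈ e, a ∈ S} ∧
      ∀ e ∈ F.edgeSet, (∀ a ∈ e, a ∈ S) → g e ∈ X ∧ ∀ a ∈ e, φ a ≠ g e := by
  classical
  have h3 := three_le_edges F hconn hnotstar u w huw
  have hScard : S.ncard ≤ Q.card := by
    have h1 := hconn.card_vert_le_card_edgeSet_add_one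
    have h2 : S.ncard ≤ Nat.card α := Set.ncard_le_card S
    have h4 : Nat.card F.edgeSet = F.edgeSet.ncard := rfl
    omega
  have : Nonempty V := ⟨x⟩
  obtain ⟨φ0, hφ0Q, hφ0⟩ : ∃ f : α → V, S ⊆ f ⁻¹' (Q : Set V) ∧ Set.InjOn f S := by
    apply Set.Finite.exists_injOn_of_encard_le (Set.toFinite S)
    rw [← (Set.toFinite S).cast_ncard_eq, Set.encard_coe_eq_coe_finsetCard]
    exact_mod_cast hScard
  have swapQ : ∀ s t z : V, s ∈ Q → t ∈ Q → z ∈ Q → Equiv.swap s t z ∈ Q := by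
    intro s t z hs ht hz
    rw [Equiv.swap_apply_def]; split_ifs <;> assumption
  set φ1 : α → V := fun a => Equiv.swap (φ0 u) x (φ0 a) with hφ1
  have hφ1u : φ1 u = x := by simp [hφ1]
  have hφ1Q : ∀ a ∈ S, φ1 a ∈ Q := fun a ha => swapQ _ _ _ (hφ0Q huS) hx (hφ0Q ha)
  have hφ1i : Set.InjOn φ1 S := fun a ha b hb h => hφ0 ha hb ((Equiv.swap _ _).injective h)
  -- the trivial case
  by_cases hE : ∃ e ∈ F.edgeSet, ∀ a ∈ e, a ∈ S
  swap
  · refine ⟨φ1, fun _ => x, hφ1u, hφ1i, hφ1Q, ?_, ?_⟩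
    · rintro e ⟨h1, h2⟩
      exact (hE ⟨e, h1, h2⟩).elim
    · intro e h1 h2
      exact (hE ⟨e, h1, h2⟩).elim
  obtain ⟨c, huc, hcS⟩ : ∃ c, F.Adj u c ∧ c ∈ S := by
    obtain ⟨e, he, heS⟩ := hE
    obtain ⟨d, hdS, hdu⟩ : ∃ d ∈ S, d ≠ u := by
      induction e with
      | h a b =>
        have hab : a ≠ b := F.ne_of_adj he
        by_cases ha : a = u
        · exact ⟨b, heS b (by simp), by grind⟩
        · exact ⟨a, heS a (by simp), ha⟩
    obtain ⟨p, q, hpq, hp, hq⟩ := hconn.crossing (S \ {u}) (a := d) (b := u) ⟨hdS, hdu⟩ (by simp)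
    by_cases hqu : q = u
    · subst hqu; exact ⟨p, hpq.symm, hp.1⟩
    · exact (hp.2 (hsep p q hpq hp.1 (fun h => hq ⟨h, hqu⟩)).1).elim
  have hcu : c ≠ u := (F.ne_of_adj huc).symm
  obtain ⟨y, hyQ, hyX, hyx⟩ : ∃ y ∈ Q, y ∉ X ∧ y ≠ x := by
    obtain ⟨y, hy, hy'⟩ := Finset.exists_mem_notMem_of_card_lt_card
      (s := insert x X) (t := Q) (by have := Finset.card_insert_le x X; omega)
    exact ⟨y, hy, by grind⟩
  obtain ⟨φ, hφu, hφc, hφi, hφQ⟩ : ∃ φ : α → V, φ u = x ∧ φ c = y ∧ Set.InjOn φ S ∧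
      ∀ a ∈ S, φ a ∈ Q := by
    refine ⟨fun a => Equiv.swap (φ1 c) y (φ1 a), ?_, by simp, ?_, ?_⟩
    · simp only [hφ1u]
      apply Equiv.swap_apply_of_ne_of_ne _ hyx.symm
      rw [← hφ1u]
      exact fun h => hcu (hφ1i hcS huS h.symm)
    · exact fun a ha b hb h => hφ1i ha hb ((Equiv.swap _ _).injective h)
    · exact fun a ha => swapQ _ _ _ (hφ1Q c hcS) hyQ (hφ1Q a ha)
  set E : Set (Sym2 α) := {e | e ∈ F.edgeSet ∧ ∀ a ∈ e, a ∈ S} with hEdef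
  have huwE : s(u, w) ∉ E := fun h => hwS (h.2 w (by simp))
  have hEsub : insert s(u, w) E ⊆ F.edgeSet := by
    rintro e (rfl | h)
    · exact huw
    · exact h.1
  have hEcard : E.ncard + 1 ≤ F.edgeSet.ncard := by
    rw [← Set.ncard_insert_of_notMem huwE (Set.toFinite _)]
    exact Set.ncard_le_ncard hEsub (Set.toFinite _)
  let N : E → Finset V := fun e => X.filter (fun z => ∀ a ∈ e.1, φ a ≠ z)
  have hall : ∀ T : Finset E, T.card ≤ (T.biUnion N).card := by
    intro T
    rcases Nat.lt_or_ge T.card 2 with hT | hT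
    · rcases T.eq_empty_or_nonempty with rfl | ⟨e, heT⟩
      · simp
      suffices h : (N e).Nonempty by
        obtain ⟨z, hz⟩ := h
        have : (T.biUnion N).Nonempty := ⟨z, Finset.mem_biUnion.2 ⟨e, heT, hz⟩⟩
        have := this.card_pos
        omega
      by_contra hne
      rw [Finset.not_nonempty_iff_eq_empty] at hne
      obtain ⟨⟨e, heF, heS⟩, rfl⟩ : ∃ e' : E, e' = e := ⟨e, rfl⟩
      induction e with
      | h a b =>
        have hsub : X ⊆ {φ a, φ b} := by
          intro z hz
          by_contra hz2
          have : z ∈ N ⟨s(a, b), heF, heS⟩ := by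
            simp only [N, Finset.mem_filter]
            refine ⟨hz, ?_⟩
            simp at hz2 ⊢
            grind
          rw [hne] at this
          simp at this
        have hc2 := Finset.card_le_card hsub
        have hc3 : ({φ a, φ b} : Finset V).card ≤ 2 := Finset.card_le_two
        have hXeq : X = {φ a, φ b} := Finset.eq_of_subset_of_card_le hsub (by omega)
        have hca : c ≠ a := by rintro rfl; apply hyX; rw [hXeq, ← hφc]; simp
        have hcb : c ≠ b := by rintro rfl; apply hyX; rw [hXeq, ← hφc]; simp
        have haS : a ∈ S := heS a (by simp)
        have hbS : b ∈ S := heS b (by simp)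
        have hcw : c ≠ w := by rintro rfl; exact hwS hcS
        have haw : a ≠ w := by rintro rfl; exact hwS haS
        have hbw : b ≠ w := by rintro rfl; exact hwS hbS
        have huw' := F.ne_of_adj huw
        have h3c : ({s(u, w), s(u, c), s(a, b)} : Set (Sym2 α)).ncard = 3 :=
          Set.ncard_eq_three.2 ⟨_, _, _, by simp; grind, by simp; grind, by simp; grind, rfl⟩
        have hFE : ({s(u, w), s(u, c), s(a, b)} : Set (Sym2 α)) = F.edgeSet := by
          apply Set.eq_of_subset_of_ncard_le _ (by omega) (Set.toFinite _)
          rintro z (rfl | rfl | rfl)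
          · exact huw
          · exact huc
          · exact heF
        by_cases hu : u = a ∨ u = b
        · apply hnotstar
          refine ⟨u, fun e he => ?_⟩
          rw [← hFE] at he
          rcases he with rfl | rfl | rfl
          · simp
          · simp
          · simpa using hu
        · obtain ⟨p, q, hpq, hp, hq⟩ := hconn.crossing {a, b} (a := a) (b := u) (by simp)
            (by simpa using hu)
          have : s(p, q) ∈ F.edgeSet := hpq
          rw [← hFE] at this
          simp at this hp hq
          grind
    · obtain ⟨e1, he1, e2, he2, hne⟩ := Finset.one_lt_card.1 hT
      -- at most one missing element
      have hmiss : ∀ z1 ∈ X, ∀ z2 ∈ X, z1 ∉ T.biUnion N → z2 ∉ T.biUnion N → z1 = z2 := by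
        intro z1 hz1 z2 hz2 h1 h2
        by_contra hz
        simp only [N, Finset.mem_biUnion, Finset.mem_filter, not_exists, not_and] at h1 h2
        have a1 := h1 e1 he1 hz1
        have b1 := h1 e2 he2 hz1
        have a2 := h2 e1 he1 hz2
        have b2 := h2 e2 he2 hz2
        push Not at a1 b1 a2 b2
        obtain ⟨p, hp, rfl⟩ := a1
        obtain ⟨p', hp', hpp⟩ := b1
        obtain ⟨q, hq, rfl⟩ := a2
        obtain ⟨q', hq', hqq⟩ := b2
        have := hφi (e2.2.2 _ hp') (e1.2.2 _ hp) hpp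
        subst this
        have := hφi (e2.2.2 _ hq') (e1.2.2 _ hq) hqq
        subst this
        have hpq : p' ≠ q' := by rintro rfl; exact hz rfl
        apply hne
        apply Subtype.ext
        rw [(Sym2.mem_and_mem_iff hpq).1 ⟨hp, hq⟩, (Sym2.mem_and_mem_iff hpq).1 ⟨hp', hq'⟩]
      have hsubX : T.biUnion N ⊆ X := by
        intro z hz
        simp only [N, Finset.mem_biUnion, Finset.mem_filter] at hz
        exact hz.choose_spec.2.1
      have hsd : (X \ T.biUnion N).card ≤ 1 := by
        apply Finset.card_le_one.2
        intro z1 h1 z2 h2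
        rw [Finset.mem_sdiff] at h1 h2
        exact hmiss _ h1.1 _ h2.1 h1.2 h2.2
      have hcs := Finset.card_sdiff_add_card_eq_card hsubX
      by_contra hlt
      push Not at hlt
      have hTE : T.card ≤ E.ncard := by
        rw [← Nat.card_coe_set_eq, Nat.card_eq_fintype_card]; exact Finset.card_le_univ T
      have hTu : T = Finset.univ := by
        apply Finset.eq_univ_of_card
        rw [← Nat.card_eq_fintype_card, Nat.card_coe_set_eq]
        omega
      have hFE : insert s(u, w) E = F.edgeSet := by
        apply Set.eq_of_subset_of_ncard_le hEsub _ (Set.toFinite _)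
        rw [Set.ncard_insert_of_notMem huwE (Set.toFinite _)]
        omega
      obtain ⟨z, hz⟩ : (X \ T.biUnion N).Nonempty := Finset.card_pos.1 (by omega)
      rw [Finset.mem_sdiff] at hz
      obtain ⟨hzX, hz⟩ := hz
      simp only [N, Finset.mem_biUnion, Finset.mem_filter, not_exists, not_and] at hz
      have hz' : ∀ e (he : e ∈ E), ∃ a ∈ e, φ a = z := by
        intro e he
        have := hz ⟨e, he⟩ (by rw [hTu]; simp) hzX
        push Not at this
        exact this
      obtain ⟨d, hd, hdz⟩ := hz' s(u, c) ⟨huc, by simp [huS, hcS]⟩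
      simp only [Sym2.mem_iff] at hd
      rcases hd with rfl | rfl
      · apply hnotstar
        refine ⟨d, fun e he => ?_⟩
        rw [← hFE] at he
        rcases he with rfl | he
        · simp
        · obtain ⟨a, ha, haz⟩ := hz' e he
          have := hφi (he.2 a ha) huS (haz.trans hdz.symm)
          rwa [← this]
      · apply hyX
        rw [← hφc, hdz]; exact hzX
  obtain ⟨g, hg, hgN⟩ := (Finset.all_card_le_biUnion_card_iff_exists_injective N).1 hall
  refine ⟨φ, fun e => if h : e ∈ E then g ⟨e, h⟩ else x, hφu, hφi, hφQ, ?_, ?_⟩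
  · intro e he e' he' h
    simp only [dif_pos he, dif_pos he'] at h
    exact congrArg Subtype.val (hg h)
  · intro e he heS
    have hmem : e ∈ E := ⟨he, heS⟩
    have := hgN ⟨e, hmem⟩
    simp only [dif_pos hmem]
    simp only [N, Finset.mem_filter] at this
    exact this

theorem combine_lemma {α V : Type*} [Fintype α] [DecidableEq V] (F : SimpleGraph α)
    (hconn : F.Connected)
    (hnotstar : ¬ ∃ c : α, ∀ e ∈ F.edgeSet, c ∈ e)
    (u w : α) (huw : F.Adj u w)
    (hcut : ¬ (F.deleteEdges {s(u, w)}).Connected)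
    (Q1 X1 Q2 X2 : Finset V) (hX1Q : X1 ⊆ Q1) (hX2Q : X2 ⊆ Q2)
    (hX1 : X1.card + 1 = F.edgeSet.ncard) (hX2 : X2.card + 1 = F.edgeSet.ncard)
    (hQ1 : F.edgeSet.ncard + 1 ≤ Q1.card) (hQ2 : F.edgeSet.ncard + 1 ≤ Q2.card)
    (hdisj : Disjoint Q1 Q2) (H : Finset (Finset V))
    (hH1 : ∀ z ∈ X1, Q1.erase z ∈ H) (hH2 : ∀ z ∈ X2, Q2.erase z ∈ H)
    (h : Finset V) (hh : h ∈ H) (x y : V) (hx : x ∈ Q1) (hy : y ∈ Q2) (hxh : x ∈ h) (hyh : y ∈ h) :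
    F.IsBergeCopyIn H := by
  classical
  set S : Set α := {a | (F.deleteEdges {s(u, w)}).Reachable u a} with hS
  have huS : u ∈ S := SimpleGraph.Reachable.refl _
  have hwS : w ∉ S := by
    intro hw
    apply hcut
    apply hconn.connected_delete_edge_of_not_isBridge
    rw [SimpleGraph.isBridge_iff]
    exact fun h => h hw
  have hsep : ∀ a b, F.Adj a b → a ∈ S → b ∉ S → a = u ∧ b = w := by
    intro a b hab ha hb
    have : s(a, b) = s(u, w) := by
      by_contra hne
      apply hb
      have hadj : (F.deleteEdges {s(u, w)}).Adj a b := by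
        rw [SimpleGraph.deleteEdges_adj]
        exact ⟨hab, hne⟩
      exact SimpleGraph.Reachable.trans ha hadj.reachable
    rcases Sym2.eq_iff.1 this with h | ⟨rfl, rfl⟩
    · exact h
    · exact (hwS ha).elim
  obtain ⟨φ1, g1, hφ1u, hφ1i, hφ1Q, hg1i, hg1⟩ := emb_lemma F hconn hnotstar u w huw S huS hwS hsep
    Q1 X1 hX1 hQ1 x hx
  obtain ⟨φ2, g2, hφ2u, hφ2i, hφ2Q, hg2i, hg2⟩ := emb_lemma F hconn hnotstar w u huw.symm Sᶜ hwS
    (fun h => h huS)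
    (fun a b hab ha hb => (hsep b a hab.symm (not_not.1 hb) ha).symm)
    Q2 X2 hX2 hQ2 y hy
  have hdis : ∀ z, z ∈ Q1 → z ∈ Q2 → False := fun z h1 h2 => Finset.disjoint_left.1 hdisj h1 h2
  let φ : α → V := fun a => if a ∈ S then φ1 a else φ2 a
  have hφS : ∀ a, a ∈ S → φ a = φ1 a := fun a ha => if_pos ha
  have hφS' : ∀ a, a ∉ S → φ a = φ2 a := fun a ha => if_neg ha
  have hcases : ∀ e ∈ F.edgeSet, e = s(u, w) ∨ (∀ a ∈ e, a ∈ S) ∨ (∀ a ∈ e, a ∉ S) := by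
    intro e he
    induction e with
    | h a b =>
      by_cases ha : a ∈ S <;> by_cases hb : b ∈ S
      · right; left; simp [ha, hb]
      · left; obtain ⟨rfl, rfl⟩ := hsep a b he ha hb; rfl
      · left; obtain ⟨rfl, rfl⟩ := hsep b a (SimpleGraph.Adj.symm he) hb ha; exact Sym2.eq_swap
      · right; right; simp [ha, hb]
  have hn1 : ¬ ∀ a ∈ s(u, w), a ∈ S := fun h => hwS (h w (by simp))
  let f : Sym2 α → Finset V := fun e => if e = s(u, w) then h else
    if ∀ a ∈ e, a ∈ S then Q1.erase (g1 e) else Q2.erase (g2 e)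
  have hfuw : f s(u, w) = h := if_pos rfl
  have hf1 : ∀ e, (∀ a ∈ e, a ∈ S) → f e = Q1.erase (g1 e) := by
    intro e he
    have : e ≠ s(u, w) := by rintro rfl; exact hn1 he
    simp only [f, if_neg this, if_pos he]
  have hf2 : ∀ e, (∀ a ∈ e, a ∉ S) → f e = Q2.erase (g2 e) := by
    intro e he
    have h1 : e ≠ s(u, w) := by rintro rfl; exact he u (by simp) huS
    have h2 : ¬ ∀ a ∈ e, a ∈ S := by
      intro h
      induction e with
      | h a b => exact he a (by simp) (h a (by simp))
    simp only [f, if_neg h1, if_neg h2]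
  have hmem : ∀ e ∈ F.edgeSet, f e ∈ H ∧ ∀ a ∈ e, φ a ∈ f e := by
    intro e he
    rcases hcases e he with rfl | hc | hc
    · rw [hfuw]
      refine ⟨hh, ?_⟩
      intro a ha
      rw [Sym2.mem_iff] at ha
      rcases ha with rfl | rfl
      · rw [hφS _ huS, hφ1u]; exact hxh
      · rw [hφS' _ hwS, hφ2u]; exact hyh
    · rw [hf1 e hc]
      refine ⟨hH1 _ (hg1 e he hc).1, fun a ha => ?_⟩
      rw [hφS _ (hc a ha)]
      exact Finset.mem_erase.2 ⟨(hg1 e he hc).2 a ha, hφ1Q a (hc a ha)⟩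
    · rw [hf2 e hc]
      refine ⟨hH2 _ (hg2 e he hc).1, fun a ha => ?_⟩
      rw [hφS' _ (hc a ha)]
      exact Finset.mem_erase.2 ⟨(hg2 e he hc).2 a ha, hφ2Q a (hc a ha)⟩
  have hsub1 : ∀ e, (∀ a ∈ e, a ∈ S) → f e ⊆ Q1 := fun e he => by
    rw [hf1 e he]; exact Finset.erase_subset _ _
  have hsub2 : ∀ e, (∀ a ∈ e, a ∉ S) → f e ⊆ Q2 := fun e he => by
    rw [hf2 e he]; exact Finset.erase_subset _ _
  have hx12 : ∀ e ∈ F.edgeSet, ∀ e', (∀ a ∈ e, a ∈ S) → (∀ a ∈ e', a ∉ S) → f e ≠ f e' := by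
    intro e he e' h1 h2 heq
    induction e with
    | h a b =>
      have := (hmem _ he).2 a (by simp)
      exact hdis _ (hsub1 _ h1 this) (hsub2 _ h2 (heq ▸ this))
  refine ⟨φ, f, ?_, ?_, hmem⟩
  · intro a b hab
    by_cases ha : a ∈ S <;> by_cases hb : b ∈ S
    · rw [hφS a ha, hφS b hb] at hab; exact hφ1i ha hb hab
    · rw [hφS a ha, hφS' b hb] at hab
      exact (hdis _ (hφ1Q a ha) (hab ▸ hφ2Q b hb)).elim
    · rw [hφS' a ha, hφS b hb] at hab
      exact (hdis _ (hφ1Q b hb) (hab ▸ hφ2Q a ha)).elim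
    · rw [hφS' a ha, hφS' b hb] at hab; exact hφ2i ha hb hab
  · intro e he e' he' heq
    rcases hcases e he with rfl | hc | hc <;> rcases hcases e' he' with rfl | hc' | hc'
    · rfl
    · rw [hfuw] at heq
      exact (hdis y (hsub1 _ hc' (heq ▸ hyh)) hy).elim
    · rw [hfuw] at heq
      exact (hdis x hx (hsub2 _ hc' (heq ▸ hxh))).elim
    · rw [hfuw] at heq
      exact (hdis y (hsub1 _ hc (heq ▸ hyh)) hy).elim
    · rw [hf1 e hc, hf1 e' hc'] at heq
      exact hg1i ⟨he, hc⟩ ⟨he', hc'⟩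
        (Finset.erase_injOn _ (hX1Q (hg1 e he hc).1) (hX1Q (hg1 e' he' hc').1) heq)
    · exact (hx12 e he e' hc hc' heq).elim
    · rw [hfuw] at heq
      exact (hdis x hx (hsub2 _ hc (heq ▸ hxh))).elim
    · exact (hx12 e' he' e hc' hc heq.symm).elim
    · rw [hf2 e hc, hf2 e' hc'] at heq
      exact hg2i ⟨he, hc⟩ ⟨he', hc'⟩
        (Finset.erase_injOn _ (hX2Q (hg2 e he hc).1) (hX2Q (hg2 e' he' hc').1) heq)

theorem free_lemma {α V : Type*} [Fintype α] [DecidableEq V] (F : SimpleGraph α)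
    (hconn : F.Connected) (u : α) (b : V → ℕ) (H : Finset (Finset V))
    (hH : ∀ h ∈ H, ∀ x ∈ h, ∀ y ∈ h, b x = b y)
    (hcard : ∀ i, ∀ T : Finset (Finset V), (∀ h ∈ T, h ∈ H ∧ ∃ x ∈ h, b x = i) →
      T.card < F.edgeSet.ncard) :
    ¬ F.IsBergeCopyIn H := by
  classical
  rintro ⟨φ, f, hφ, hf, hfe⟩
  have hb : ∀ a, b (φ a) = b (φ u) := by
    by_contra hne
    push Not at hne
    obtain ⟨a, ha⟩ := hne
    obtain ⟨p, q, hpq, hp, hq⟩ := hconn.crossing {z | b (φ z) = b (φ u)} (a := u) (b := a) rfl ha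
    have := hfe s(p, q) hpq
    exact hq ((hH _ this.1 _ (this.2 q (by simp)) _ (this.2 p (by simp))).trans hp)
  have h1 : F.edgeSet.ncard ≤ (H.filter (fun h => ∃ x ∈ h, b x = b (φ u))).card := by
    rw [← Set.ncard_coe_finset]
    apply Set.ncard_le_ncard_of_injOn f _ hf (Finset.finite_toSet _)
    intro e he
    have := hfe e he
    induction e with
    | h p q =>
      simp only [Finset.coe_filter, Set.mem_ofPred_eq]
      exact ⟨this.1, φ p, this.2 p (by simp), hb p⟩
  exact absurd (hcard (b (φ u)) _ (fun h hh => Finset.mem_filter.1 hh)) (not_lt.2 h1)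

/-- If `F` is connected, is not a star, and has a cut-edge `(u,w)`, then for any
`r ≥ e(F)` the Berge saturation number of `F` is at most `C·n`. -/
theorem stmt9 {α : Type*} [Fintype α] (F : SimpleGraph α)
    (hconn : F.Connected)
    (hnotstar : ¬ ∃ c : α, ∀ e ∈ F.edgeSet, c ∈ e)
    (u w : α) (huw : F.Adj u w)
    (hcut : ¬ (F.deleteEdges {s(u, w)}).Connected)
    (r : ℕ) (hr : F.edgeSet.ncard ≤ r) :
    ∃ C : ℕ, ∀ n : ℕ, ∃ H : Finset (Finset (Fin n)),
      BergeSaturated F r n H ∧ H.card ≤ C * n := by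
  classical
  have h3 := three_le_edges F hconn hnotstar u w huw
  set m := F.edgeSet.ncard with hm
  set K := r + 1 with hK
  refine ⟨2 ^ (2 * K), fun n => ?_⟩
  let b : Fin n → ℕ := fun v => v.val / K
  let Q : ℕ → Finset (Fin n) := fun i => Finset.univ.filter (fun v => b v = i)
  have hQmem : ∀ i v, v ∈ Q i ↔ b v = i := by intro i v; simp [Q]
  have hKpos : 0 < K := by omega
  have hQle : ∀ i, (Q i).card ≤ K := by
    intro i
    rw [← Finset.card_range K]
    apply Finset.card_le_card_of_injOn (fun v => v.val % K)
    · intro v _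
      simpa using Nat.mod_lt _ hKpos
    · intro v hv v' hv' h
      have h1 : v.val / K = i := (hQmem i v).1 hv
      have h2 : v'.val / K = i := (hQmem i v').1 hv'
      have h4 : v.val % K = v'.val % K := h
      apply Fin.ext
      rw [← Nat.div_add_mod v.val K, ← Nat.div_add_mod v'.val K, h1, h2, h4]
  have hQge : ∀ i, i < n / K → (Q i).card = K := by
    intro i hi
    apply le_antisymm (hQle i)
    have hlt : ∀ j, j < K → i * K + j < n := by
      intro j hj
      have h1 : (i + 1) * K ≤ n / K * K := Nat.mul_le_mul_right _ hi
      have h2 := Nat.div_mul_le_self n K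
      have h4 : (i + 1) * K = i * K + K := by ring
      omega
    have : (Finset.univ : Finset (Fin K)).card ≤ (Q i).card := by
      apply Finset.card_le_card_of_injOn (fun j : Fin K => (⟨i * K + j, hlt j j.2⟩ : Fin n))
      · intro j _
        refine (hQmem _ _).2 ?_
        change (i * K + j) / K = i
        rw [mul_comm, Nat.mul_add_div hKpos, Nat.div_eq_of_lt j.2, add_zero]
      · intro j _ j' _ h
        simp only [Fin.mk.injEq] at h
        exact Fin.ext (by omega)
    simpa using this
  have hXex : ∀ i, ∃ X ⊆ Q i, i < n / K → X.card = m - 1 := by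
    intro i
    by_cases hi : i < n / K
    · obtain ⟨X, hX, hc⟩ := Finset.exists_subset_card_eq (s := Q i) (n := m - 1)
        (by rw [hQge i hi]; omega)
      exact ⟨X, hX, fun _ => hc⟩
    · exact ⟨∅, by simp, fun h => (hi h).elim⟩
  choose X hXQ hXc using hXex
  let H0 : Finset (Finset (Fin n)) :=
    (Finset.range (n / K)).biUnion fun i => (X i).image (fun v => (Q i).erase v)
  have hH0 : ∀ h, h ∈ H0 ↔ ∃ i < n / K, ∃ v ∈ X i, (Q i).erase v = h := by
    intro h; simp [H0]
  have hH0b : ∀ h ∈ H0, ∀ x ∈ h, ∀ y ∈ h, b x = b y := by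
    intro h hh x hx y hy
    obtain ⟨i, hi, v, hv, rfl⟩ := (hH0 h).1 hh
    rw [(hQmem i x).1 (Finset.mem_of_mem_erase hx), (hQmem i y).1 (Finset.mem_of_mem_erase hy)]
  have hfree0 : ¬ F.IsBergeCopyIn H0 := by
    apply free_lemma F hconn u b H0 hH0b
    intro i T hT
    have hsub : T ⊆
        if i < n / K then (X i).image (fun v => (Q i).erase v) else ∅ := by
      intro h hh
      obtain ⟨hh, x, hx, rfl⟩ := hT h hh
      obtain ⟨j, hj, v, hv, rfl⟩ := (hH0 h).1 hh
      have := (hQmem j x).1 (Finset.mem_of_mem_erase hx)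
      subst this
      rw [if_pos hj]
      exact Finset.mem_image_of_mem _ hv
    have h1 := Finset.card_le_card hsub
    split_ifs at h1 with hi
    · have h2 := (Finset.card_image_le (s := X i) (f := fun v => (Q i).erase v))
      rw [hXc i hi] at h2
      omega
    · simp only [Finset.card_empty] at h1
      omega
  have hunif0 : ∀ h ∈ H0, h.card = r := by
    intro h hh
    obtain ⟨i, hi, v, hv, rfl⟩ := (hH0 h).1 hh
    rw [Finset.card_erase_of_mem (hXQ i hv), hQge i hi]
    omega
  obtain ⟨H, hle, hmax⟩ := Finite.exists_le_maximal
    (p := fun H : Finset (Finset (Fin n)) => (∀ h ∈ H, h.card = r) ∧ ¬ F.IsBergeCopyIn H)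
    (a := H0) ⟨hunif0, hfree0⟩
  refine ⟨H, ⟨hmax.prop.1, hmax.prop.2, ?_⟩, ?_⟩
  · intro h hr' hh
    by_contra hno
    apply hh
    have hp : (∀ h' ∈ insert h H, h'.card = r) ∧ ¬ F.IsBergeCopyIn (insert h H) := by
      refine ⟨fun h' hh' => ?_, ?_⟩
      · rcases Finset.mem_insert.1 hh' with rfl | h2
        · exact hr'
        · exact hmax.prop.1 _ h2
      · convert hno
    exact hmax.le_of_ge hp (Finset.subset_insert h H) (Finset.mem_insert_self h H)
  · have hblock : ∀ h ∈ H, ∀ x ∈ h, ∀ y ∈ h, b x < n / K → b y < n / K → b x = b y := by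
      intro h hh x hx y hy hbx hby
      by_contra hne
      apply hmax.prop.2
      refine combine_lemma F hconn hnotstar u w huw hcut (Q (b x)) (X (b x)) (Q (b y)) (X (b y))
        (hXQ _) (hXQ _) (by rw [hXc _ hbx]; omega) (by rw [hXc _ hby]; omega)
        (by rw [hQge _ hbx]; omega) (by rw [hQge _ hby]; omega) ?_ H ?_ ?_ h hh x y
        ((hQmem _ _).2 rfl) ((hQmem _ _).2 rfl) hx hy
      · rw [Finset.disjoint_left]
        intro z hz1 hz2
        exact hne (((hQmem _ _).1 hz1).symm.trans ((hQmem _ _).1 hz2))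
      · exact fun z hz => hle ((hH0 _).2 ⟨_, hbx, z, hz, rfl⟩)
      · exact fun z hz => hle ((hH0 _).2 ⟨_, hby, z, hz, rfl⟩)
    have hlast : ∀ v : Fin n, ¬ b v < n / K → b v = n / K := by
      intro v hv
      have : v.val / K ≤ n / K := Nat.div_le_div_right v.2.le
      exact le_antisymm this (not_lt.1 hv)
    have hsub : H ⊆ (Finset.univ : Finset (Fin n)).biUnion
        (fun v => (Q (b v) ∪ Q (n / K)).powerset) := by
      intro h hh
      have hne : h.Nonempty := Finset.card_pos.1 (by rw [hmax.prop.1 h hh]; omega)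
      simp only [Finset.mem_biUnion, Finset.mem_univ, true_and, Finset.mem_powerset]
      by_cases hex : ∃ v ∈ h, b v < n / K
      · obtain ⟨v, hv, hvb⟩ := hex
        refine ⟨v, fun z hz => ?_⟩
        rw [Finset.mem_union, hQmem, hQmem]
        by_cases hzb : b z < n / K
        · exact Or.inl (hblock h hh z hz v hv hzb hvb)
        · exact Or.inr (hlast z hzb)
      · push Not at hex
        obtain ⟨v, hv⟩ := hne
        refine ⟨v, fun z hz => ?_⟩
        rw [Finset.mem_union, hQmem, hQmem]
        exact Or.inr (hlast z (not_lt.2 (hex z hz)))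
    refine (Finset.card_le_card hsub).trans ?_
    refine (Finset.card_biUnion_le_card_mul _ _ (2 ^ (2 * K)) ?_).trans ?_
    · intro v _
      rw [Finset.card_powerset]
      apply Nat.pow_le_pow_right (by norm_num)
      have h1 := Finset.card_union_le (Q (b v)) (Q (n / K))
      have h2 := hQle (b v)
      have h4 := hQle (n / K)
      omega
    · rw [Finset.card_univ, Fintype.card_fin, mul_comm]
end

section
/- Let F be a graph with an isolated edge (u₁,u₂) and no isolated vertex, let F' = F − {u₁u₂} (remove the edge and both its endpoints), v = |V(F)|, and r ≥ v. Let C be a set of v − 2 vertices inside an n-set U (n ≥ r + 2), and let G consist of e(F) − 1 distinct r-subsets of U each containing C. Then G is Berge-F-saturated-in-the-weak-sense: adding any r-set h ⊆ U with |h \ C| ≥ 2 creates a Berge copy of F. -/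
/-- Let `F` (on `v` vertices, no isolated vertex) have an isolated edge `(u₁,u₂)`, let
`r ≥ v`, and let `G` consist of `e(F) − 1` distinct `r`-subsets of an `n`-set all
containing a fixed `(v−2)`-set `C`. Then adding any new `r`-set `h` with `|h \ C| ≥ 2`
creates a Berge copy of `F`. -/
theorem stmt17 {α : Type*} [Fintype α] (F : SimpleGraph α)
    (hnoiso : ∀ x : α, ∃ y : α, F.Adj x y)
    (u₁ u₂ : α) (h12 : F.Adj u₁ u₂)
    (hd1 : F.neighborSet u₁ = {u₂}) (hd2 : F.neighborSet u₂ = {u₁})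
    (v r n : ℕ) (hv : Fintype.card α = v) (hrv : v ≤ r) (hn : r + 2 ≤ n)
    (C : Finset (Fin n)) (hC : C.card = v - 2)
    (G : Finset (Finset (Fin n))) (hG : ∀ g ∈ G, g.card = r ∧ C ⊆ g)
    (hGcard : G.card = F.edgeSet.ncard - 1) :
    ∀ h : Finset (Fin n), h.card = r → 2 ≤ (h \ C).card → h ∉ G →
      F.IsBergeCopyIn (insert h G) := by
  classical
  intro h _ h2 hhG
  obtain ⟨p, hp, q, hq, hpq⟩ := Finset.one_lt_card.1 (show 1 < (h \ C).card by omega)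
  rw [Finset.mem_sdiff] at hp hq
  have hne : u₁ ≠ u₂ := h12.ne
  haveI : Nonempty (Fin n) := ⟨p⟩
  -- embed the remaining vertices into C
  obtain ⟨ψ, hψC, hψ⟩ : ∃ ψ : α → Fin n,
      (((Finset.univ \ {u₁, u₂} : Finset α) : Set α) ⊆ ψ ⁻¹' (C : Set (Fin n))) ∧
      Set.InjOn ψ ((Finset.univ \ {u₁, u₂} : Finset α) : Set α) := by
    apply Set.Finite.exists_injOn_of_encard_le (Finset.finite_toSet _)
    rw [Set.encard_coe_eq_coe_finsetCard, Set.encard_coe_eq_coe_finsetCard, hC,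
      Finset.card_sdiff_of_subset (Finset.subset_univ _), Finset.card_univ, hv,
      Finset.card_pair hne]
  -- assign the remaining edges to hyperedges of G
  obtain ⟨f, hfG, hf⟩ : ∃ f : Sym2 α → Finset (Fin n),
      (F.edgeSet \ {s(u₁, u₂)} ⊆ f ⁻¹' (G : Set (Finset (Fin n)))) ∧
      Set.InjOn f (F.edgeSet \ {s(u₁, u₂)}) := by
    apply Set.Finite.exists_injOn_of_encard_le (Set.toFinite _)
    rw [Set.encard_coe_eq_coe_finsetCard, hGcard, ← (Set.toFinite _).cast_ncard_eq,
      Set.ncard_diff_singleton_of_mem (show s(u₁, u₂) ∈ F.edgeSet from h12)]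
  have hψC' : ∀ x, x ≠ u₁ → x ≠ u₂ → ψ x ∈ C := fun x h1 h2 => by
    have := @hψC x (by simp [h1, h2])
    simpa using this
  have hψ' : ∀ x y, x ≠ u₁ → x ≠ u₂ → y ≠ u₁ → y ≠ u₂ → ψ x = ψ y → x = y :=
    fun x y h1 h2 h3 h4 hxy => hψ (by simp [h1, h2]) (by simp [h3, h4]) hxy
  have hfG' : ∀ e ∈ F.edgeSet, e ≠ s(u₁, u₂) → f e ∈ G := fun e he hne => by
    have := @hfG e ⟨he, hne⟩
    simpa using this
  have hf' : ∀ e ∈ F.edgeSet, ∀ e' ∈ F.edgeSet, e ≠ s(u₁, u₂) → e' ≠ s(u₁, u₂) →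
      f e = f e' → e = e' := fun e he e' he' h1 h2 hh => hf ⟨he, h1⟩ ⟨he', h2⟩ hh
  have hiso : ∀ e ∈ F.edgeSet, e ≠ s(u₁, u₂) → ∀ a ∈ e, a ≠ u₁ ∧ a ≠ u₂ := by
    intro e he hne a ha
    obtain ⟨b, rfl⟩ := Sym2.mem_iff_exists.1 ha
    have hab : F.Adj a b := he
    constructor
    · rintro rfl
      have : b ∈ F.neighborSet a := hab
      rw [hd1, Set.mem_singleton_iff] at this
      exact hne (by rw [this])
    · rintro rfl
      have : b ∈ F.neighborSet a := hab
      rw [hd2, Set.mem_singleton_iff] at this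
      exact hne (by rw [this, Sym2.eq_swap])
  refine ⟨fun x => if x = u₁ then p else if x = u₂ then q else ψ x,
    fun e => if e = s(u₁, u₂) then h else f e, ?_, ?_, ?_⟩
  · intro x y hxy
    simp only at hxy
    grind
  · intro e he e' he' hee
    simp only at hee
    grind
  · intro e he
    by_cases hee : e = s(u₁, u₂)
    · subst hee
      simp only [if_true, Finset.mem_insert, true_or, true_and, Sym2.mem_iff]
      rintro a (rfl | rfl)
      · simpa using hp.1
      · simpa [hne.symm] using hq.1
    · simp only [if_neg hee]
      refine ⟨Finset.mem_insert_of_mem (hfG' e he hee), fun a ha => ?_⟩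
      obtain ⟨h1, h2⟩ := hiso e he hee a ha
      simp only [if_neg h1, if_neg h2]
      exact (hG _ (hfG' e he hee)).2 (hψC' a h1 h2)
end
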